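/- Fix real parameters a > 0 and b ∈ (0,1). Then for every sufficiently large r > 0 there exists ε₀ > 0 such that for every ε ∈ (0, ε₀) the Le Corbeiller system with parameters a, b, ε admits a nonconstant periodic solution whose image Γ_ε is contained in the closed ball of radius r centered at the origin; moreover Γ_ε is the unique such periodic orbit in that ball (the image of any nonconstant periodic solution contained in the ball equals Γ_ε), and Γ_ε is attracting: there exists an open neighborhood U of Γ_ε such that every solution with initial condition in U is defined for all forward times and its distance to Γ_ε tends to 0 as t → ∞. -/

import Mathlib

/-- The vector field of the Le Corbeiller system
`ẋ = y + a, ẏ = −x + b·y·(2 − exp(y/ε))`. -/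
noncomputable def corbeillerField (a b ε : ℝ) (p : ℝ × ℝ) : ℝ × ℝ :=
  (p.2 + a, -p.1 + b * p.2 * (2 - Real.exp (p.2 / ε)))

/-- `p` is a nonconstant periodic solution of the planar ODE with vector field `f`. -/
def IsPeriodicSol (f : ℝ × ℝ → ℝ × ℝ) (p : ℝ → ℝ × ℝ) : Prop :=
  (∀ t : ℝ, HasDerivAt p (f (p t)) t) ∧
  (∃ T > (0 : ℝ), ∀ t : ℝ, p (t + T) = p t) ∧
  (∃ t₁ t₂ : ℝ, p t₁ ≠ p t₂)

section GlobalFlow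

variable {E : Type*} [NormedAddCommGroup E] [NormedSpace ℝ E]

open Set in
/-- Two integral curves on overlapping open intervals can be glued. -/
lemma exists_glue_integral_curve {F : E → E} {K : NNReal} (hF : LipschitzWith K F)
    {A B C D s : ℝ} {p q : ℝ → E} (hAC : A ≤ C) (hs : s ∈ Ioo C B) (hBD : B ≤ D)
    (hp : ∀ t ∈ Ioo A B, HasDerivAt p (F (p t)) t)
    (hq : ∀ t ∈ Ioo C D, HasDerivAt q (F (q t)) t) (hpq : p s = q s) :
    ∃ r : ℝ → E, (∀ t ∈ Ioo A D, HasDerivAt r (F (r t)) t) ∧ (∀ t < B, r t = p t) ∧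
      ∀ t > C, t < D → r t = q t := by
  have hEq : EqOn p q (Ioo C B) :=
    ODE_solution_unique_of_mem_Ioo (v := fun _ => F) (s := fun _ => univ)
      (fun t _ => hF.lipschitzOnWith) hs
      (fun t ht => ⟨hp t ⟨hAC.trans_lt ht.1, ht.2⟩, trivial⟩)
      (fun t ht => ⟨hq t ⟨ht.1, ht.2.trans_le hBD⟩, trivial⟩) hpq
  have h1 : ∀ t < B, (if t < B then p t else q t) = p t := fun t ht => if_pos ht
  have h2 : ∀ t > C, t < D → (if t < B then p t else q t) = q t := fun t ht _ => by
    split_ifs with h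
    · exact hEq ⟨ht, h⟩
    · rfl
  refine ⟨fun t => if t < B then p t else q t, fun t ht => ?_, h1, h2⟩
  by_cases h : t < B
  · have hev : (fun t => if t < B then p t else q t) =ᶠ[nhds t] p := by
      filter_upwards [Iio_mem_nhds h] with u hu using h1 u hu
    simp only [h1 t h]
    exact (hp t ⟨ht.1, h⟩).congr_of_eventuallyEq hev
  · have hC : C < t := (hs.1.trans hs.2).trans_le (not_lt.1 h)
    have hev : (fun t => if t < B then p t else q t) =ᶠ[nhds t] q := by
      filter_upwards [Ioo_mem_nhds hC ht.2] with u hu using h2 u hu.1 hu.2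
    simp only [h2 t hC ht.2]
    exact (hq t ⟨hC, ht.2⟩).congr_of_eventuallyEq hev

open Set in
lemma exists_integral_curve_Ioo_of_lipschitz [CompleteSpace E] {F : E → E} {K : NNReal}
    (hF : LipschitzWith K F) :
    ∃ h > (0 : ℝ), ∀ z : E, ∃ p : ℝ → E, p 0 = z ∧
      ∀ t ∈ Ioo (-h) h, HasDerivAt p (F (p t)) t := by
  have hK : (0 : ℝ) ≤ K := K.2
  refine ⟨1 / (2 * (K + 1)), by positivity, fun z => ?_⟩
  set h : ℝ := 1 / (2 * (K + 1)) with hh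
  have hpos : 0 < h := by positivity
  set a : NNReal := ‖F z‖₊ + 1 with ha
  have h0 : (0 : ℝ) ∈ Icc (-h) h := ⟨by linarith, by linarith⟩
  have hPL : IsPicardLindelof (fun _ => F) (⟨0, h0⟩ : Icc (-h) h) z a 0 (‖F z‖₊ + K * a) K := by
    refine IsPicardLindelof.of_time_independent (fun x hx => ?_) hF.lipschitzOnWith ?_
    · have h1 := hF.dist_le_mul x z
      rw [Metric.mem_closedBall] at hx
      rw [dist_eq_norm] at h1
      have h2 : ‖F x‖ ≤ ‖F x - F z‖ + ‖F z‖ := norm_le_norm_sub_add _ _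
      have h3 : (K : ℝ) * dist x z ≤ K * a := by gcongr
      push_cast
      linarith
    · have : max (h - 0) (0 - -h) = h := by simp
      simp only [this]
      rw [hh, ha]
      push_cast
      have hn := norm_nonneg (F z)
      rw [mul_one_div, div_le_iff₀ (by positivity)]
      nlinarith [mul_nonneg hn hK]
  obtain ⟨p, hp0, hp⟩ := hPL.exists_eq_forall_mem_Icc_hasDerivWithinAt₀
  exact ⟨p, hp0, fun t ht => (hp t (Ioo_subset_Icc_self ht)).hasDerivAt (Icc_mem_nhds ht.1 ht.2)⟩

open Set in
/-- A globally Lipschitz vector field on a Banach space is complete. -/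
theorem exists_integral_curve_of_lipschitz [CompleteSpace E] {F : E → E} {K : NNReal}
    (hF : LipschitzWith K F) (z : E) :
    ∃ p : ℝ → E, p 0 = z ∧ ∀ t, HasDerivAt p (F (p t)) t := by
  obtain ⟨h, hpos, hloc⟩ := exists_integral_curve_Ioo_of_lipschitz hF
  have hext : ∀ n : ℕ, ∀ z : E, ∃ p : ℝ → E, p 0 = z ∧
      ∀ t ∈ Ioo (-(h * (1 + n / 2))) (h * (1 + n / 2)), HasDerivAt p (F (p t)) t := by
    intro n
    induction n with
    | zero => simpa using hloc
    | succ n ih =>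
      intro z
      obtain ⟨p, hp0, hp⟩ := ih z
      set T : ℝ := h * (1 + n / 2) with hT
      have hhT : h ≤ T := by
        rw [hT]; nlinarith [mul_nonneg hpos.le (Nat.cast_nonneg (α := ℝ) n)]
      have hsucc : h * (1 + ((n + 1 : ℕ) : ℝ) / 2) = T + h / 2 := by push_cast; rw [hT]; ring
      rw [hsucc]
      obtain ⟨q, hq0, hq⟩ := hloc (p (T - h / 2))
      obtain ⟨q', hq'0, hq'⟩ := hloc (p (-(T - h / 2)))
      have hqs : ∀ t ∈ Ioo (T - 3 * h / 2) (T + h / 2),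
          HasDerivAt (fun t => q (t - (T - h / 2))) (F (q (t - (T - h / 2)))) t := by
        intro t ht
        exact (hq _ ⟨by linarith [ht.1], by linarith [ht.2]⟩).comp_sub_const t _
      have hqs' : ∀ t ∈ Ioo (-(T + h / 2)) (-(T - 3 * h / 2)),
          HasDerivAt (fun t => q' (t - (-(T - h / 2)))) (F (q' (t - (-(T - h / 2))))) t := by
        intro t ht
        exact (hq' _ ⟨by linarith [ht.1], by linarith [ht.2]⟩).comp_sub_const t _
      obtain ⟨r, hr, hrp, -⟩ := exists_glue_integral_curve hF (s := T - h / 2)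
        (A := -T) (by linarith) ⟨by linarith, by linarith⟩ (by linarith) hp hqs (by simp [hq0])
      obtain ⟨r', hr', -, hr'r⟩ := exists_glue_integral_curve hF (s := -(T - h / 2))
        (A := -(T + h / 2)) (B := -(T - 3 * h / 2)) (C := -T) (D := T + h / 2)
        (by linarith) ⟨by linarith, by linarith⟩ (by linarith) hqs' hr
        (by rw [hrp _ (by linarith)]; simp [hq'0])
      refine ⟨r', ?_, hr'⟩
      rw [hr'r 0 (by linarith) (by linarith), hrp 0 (by linarith), hp0]
  have hall : ∀ a : ℝ, ∃ p : ℝ → E, p 0 = z ∧ ∀ t ∈ Ioo (-a) a, HasDerivAt p (F (p t)) t := by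
    intro a
    obtain ⟨n, hn⟩ := exists_nat_ge (2 * a / h)
    obtain ⟨p, hp0, hp⟩ := hext n z
    have : a ≤ h * (1 + n / 2) := by
      rw [div_le_iff₀ hpos] at hn
      nlinarith
    exact ⟨p, hp0, fun t ht => hp t ⟨by linarith [ht.1], by linarith [ht.2]⟩⟩
  choose γ hγ0 hγ using hall
  have hagree : ∀ a b t : ℝ, |t| < a → |t| < b → γ a t = γ b t := by
    intro a b t ha hb
    have hc : |t| < min a b := lt_min ha hb
    have h0 : 0 < min a b := (abs_nonneg t).trans_lt hc
    refine ODE_solution_unique_of_mem_Ioo (v := fun _ => F) (s := fun _ => univ) (t₀ := 0)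
      (a := -min a b) (b := min a b)
      (fun t _ => hF.lipschitzOnWith) ⟨by linarith, h0⟩
      (fun u hu => ⟨hγ a u ⟨?_, ?_⟩, trivial⟩)
      (fun u hu => ⟨hγ b u ⟨?_, ?_⟩, trivial⟩) (by rw [hγ0, hγ0]) (abs_lt.1 hc)
    · linarith [hu.1, min_le_left a b]
    · linarith [hu.2, min_le_left a b]
    · linarith [hu.1, min_le_right a b]
    · linarith [hu.2, min_le_right a b]
  refine ⟨fun t => γ (|t| + 1) t, hγ0 _, fun t => ?_⟩
  have hev : (fun u => γ (|u| + 1) u) =ᶠ[nhds t] γ (|t| + 1) := by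
    have : {u : ℝ | |u| < |t| + 1} ∈ nhds t :=
      (isOpen_lt continuous_abs continuous_const).mem_nhds (by simp)
    filter_upwards [this] with u hu
    exact hagree _ _ u (by linarith) hu
  exact (hγ (|t| + 1) t (abs_lt.1 (by linarith))).congr_of_eventuallyEq hev

/-- Uniqueness of global integral curves of a Lipschitz vector field. -/
lemma integral_curve_unique {F : E → E} {K : NNReal} (hF : LipschitzWith K F) {p q : ℝ → E}
    (hp : ∀ t, HasDerivAt p (F (p t)) t) (hq : ∀ t, HasDerivAt q (F (q t)) t) {s : ℝ}
    (h : p s = q s) : p = q :=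
  ODE_solution_unique_univ (v := fun _ => F) (s := fun _ => Set.univ)
    (fun _ => hF.lipschitzOnWith) (fun t => ⟨hp t, trivial⟩) (fun t => ⟨hq t, trivial⟩) h

end GlobalFlow

section ScalarTools

open Set

/-- Grönwall's inequality in the form `f' ≤ K f`. -/
lemma le_mul_exp_of_deriv_le {f f' : ℝ → ℝ} {K t₀ t₁ : ℝ} (h01 : t₀ ≤ t₁)
    (hf : ∀ t ∈ Icc t₀ t₁, HasDerivAt f (f' t) t) (h : ∀ t ∈ Icc t₀ t₁, f' t ≤ K * f t) :
    f t₁ ≤ f t₀ * Real.exp (K * (t₁ - t₀)) := by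
  have hd : ∀ t ∈ Icc t₀ t₁, HasDerivAt (fun t => f t * Real.exp (-(K * (t - t₀))))
      (f' t * Real.exp (-(K * (t - t₀))) + f t * (Real.exp (-(K * (t - t₀))) * -(K * 1))) t := by
    intro t ht
    exact (hf t ht).mul ((((hasDerivAt_id t).sub_const t₀).const_mul K).neg.exp)
  have hanti : AntitoneOn (fun t => f t * Real.exp (-(K * (t - t₀)))) (Icc t₀ t₁) := by
    refine antitoneOn_of_deriv_nonpos (convex_Icc _ _)
      (fun t ht => (hd t ht).continuousAt.continuousWithinAt)
      (fun t ht => (hd t (interior_subset ht)).differentiableAt.differentiableWithinAt)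
      (fun t ht => ?_)
    rw [(hd t (interior_subset ht)).deriv]
    nlinarith [h t (interior_subset ht), Real.exp_pos (-(K * (t - t₀)))]
  have := hanti (left_mem_Icc.2 h01) (right_mem_Icc.2 h01) h01
  simp only [sub_self, mul_zero, neg_zero, Real.exp_zero, mul_one, Real.exp_neg] at this
  rwa [← div_eq_mul_inv, div_le_iff₀ (Real.exp_pos _)] at this

/-- A function that crosses a line only with smaller slope stays below the line. -/
lemma le_line_of_deriv_lt {f f' : ℝ → ℝ} {A k t₀ t₁ : ℝ}
    (hf : ∀ t ∈ Icc t₀ t₁, HasDerivAt f (f' t) t) (h0 : f t₀ ≤ A)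
    (h : ∀ t ∈ Icc t₀ t₁, f t = A + k * (t - t₀) → f' t < k) :
    ∀ t ∈ Icc t₀ t₁, f t ≤ A + k * (t - t₀) := by
  refine image_le_of_deriv_right_lt_deriv_boundary (f' := f') (B' := fun _ => k)
    (fun t ht => (hf t ht).continuousAt.continuousWithinAt)
    (fun t ht => (hf t (Ico_subset_Icc_self ht)).hasDerivWithinAt) (by simpa using h0)
    (fun t => ?_) (fun t ht => h t (Ico_subset_Icc_self ht))
  simpa using (((hasDerivAt_id t).sub_const t₀).const_mul k).const_add A

/-- A function that crosses a line only with larger slope stays above the line. -/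
lemma line_le_of_lt_deriv {f f' : ℝ → ℝ} {A k t₀ t₁ : ℝ}
    (hf : ∀ t ∈ Icc t₀ t₁, HasDerivAt f (f' t) t) (h0 : A ≤ f t₀)
    (h : ∀ t ∈ Icc t₀ t₁, f t = A + k * (t - t₀) → k < f' t) :
    ∀ t ∈ Icc t₀ t₁, A + k * (t - t₀) ≤ f t := by
  intro t ht
  have := le_line_of_deriv_lt (f := fun t => -f t) (f' := fun t => -f' t) (A := -A) (k := -k)
    (fun t ht => (hf t ht).neg) (by simpa using h0)
    (fun t ht he => by have := h t ht (by linarith); linarith) t ht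
  linarith

lemma sub_le_mul_of_deriv_le {f f' : ℝ → ℝ} {k t₀ t₁ : ℝ} (h01 : t₀ ≤ t₁)
    (hf : ∀ t ∈ Icc t₀ t₁, HasDerivAt f (f' t) t) (h : ∀ t ∈ Icc t₀ t₁, f' t ≤ k) :
    f t₁ - f t₀ ≤ k * (t₁ - t₀) := by
  have := image_le_of_deriv_right_le_deriv_boundary (f := f) (f' := f') (a := t₀) (b := t₁)
    (B := fun t => f t₀ + k * (t - t₀)) (B' := fun _ => k)
    (fun t ht => (hf t ht).continuousAt.continuousWithinAt)
    (fun t ht => (hf t (Ico_subset_Icc_self ht)).hasDerivWithinAt) (by simp)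
    (by fun_prop)
    (fun t _ => by
      simpa using ((((hasDerivAt_id t).sub_const t₀).const_mul k).const_add
        (f t₀)).hasDerivWithinAt)
    (fun t ht => h t (Ico_subset_Icc_self ht)) (right_mem_Icc.2 h01)
  linarith

lemma mul_le_sub_of_le_deriv {f f' : ℝ → ℝ} {k t₀ t₁ : ℝ} (h01 : t₀ ≤ t₁)
    (hf : ∀ t ∈ Icc t₀ t₁, HasDerivAt f (f' t) t) (h : ∀ t ∈ Icc t₀ t₁, k ≤ f' t) :
    k * (t₁ - t₀) ≤ f t₁ - f t₀ := by
  have := sub_le_mul_of_deriv_le (f := fun t => -f t) (f' := fun t => -f' t) (k := -k) h01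
    (fun t ht => (hf t ht).neg) (fun t ht => by have := h t ht; linarith)
  linarith

/-- Reparametrization of time by a positive speed bounded away from zero. -/
lemma exists_time_change {u : ℝ → ℝ} (hu : Continuous u) {m : ℝ} (hm : 0 < m)
    (hum : ∀ t, m ≤ u t) (t₀ : ℝ) :
    ∃ τ : ℝ → ℝ, τ 0 = t₀ ∧ ∀ s, HasDerivAt τ (u (τ s))⁻¹ s := by
  set θ : ℝ → ℝ := fun t => ∫ x in t₀..t, u x with hθ
  have hd : ∀ t, HasDerivAt θ (u t) t := fun t =>
    intervalIntegral.integral_hasDerivAt_right (hu.intervalIntegrable _ _)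
      hu.stronglyMeasurable.stronglyMeasurableAtFilter hu.continuousAt
  have hmono : StrictMono θ := strictMono_of_deriv_pos fun t => by
    rw [(hd t).deriv]; exact hm.trans_le (hum t)
  have hcont : Continuous θ := continuous_iff_continuousAt.2 fun t => (hd t).continuousAt
  have hθ0 : θ t₀ = 0 := by simp [hθ]
  have hsurj : Function.Surjective θ := by
    apply hcont.surjective
    · refine Filter.tendsto_atTop_mono' _ (f₁ := fun t => m * (t - t₀)) ?_ ?_
      · filter_upwards [Filter.eventually_ge_atTop t₀] with t ht
        have := mul_le_sub_of_le_deriv ht (fun t _ => hd t) (fun t _ => hum t)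
        linarith
      · exact (Filter.tendsto_atTop_add_const_right _ (-t₀) Filter.tendsto_id).const_mul_atTop hm
    · refine Filter.tendsto_atBot_mono' _ (f₁ := fun t => m * (t - t₀)) ?_ ?_
      · filter_upwards [Filter.eventually_le_atBot t₀] with t ht
        have := mul_le_sub_of_le_deriv ht (fun t _ => hd t) (fun t _ => hum t)
        linarith
      · exact (Filter.tendsto_atBot_add_const_right _ (-t₀) Filter.tendsto_id).const_mul_atBot hm
  set e := hmono.orderIsoOfSurjective θ hsurj with he
  refine ⟨e.symm, ?_, fun s => ?_⟩
  · rw [OrderIso.symm_apply_eq]; exact hθ0.symm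
  · exact (hd (e.symm s)).of_local_left_inverse e.symm.continuous.continuousAt
      (hm.trans_le (hum _)).ne' (Filter.Eventually.of_forall fun y => e.apply_symm_apply y)

end ScalarTools

section Reference

open Set Real

/-- The trajectory through the origin of the limiting linear system, up to its first return to
the line `y = 0`. -/
lemma exists_reference_trajectory {a b : ℝ} (ha : 0 < a) (hb0 : 0 < b) (hb1 : b < 1) :
    ∃ (x y : ℝ → ℝ) (T : ℝ), 0 < T ∧ (∀ t, HasDerivAt x (y t + a) t) ∧
      (∀ t, HasDerivAt y (-x t + 2 * b * y t) t) ∧ x 0 = 0 ∧ y 0 = 0 ∧ y T = 0 ∧ x T < 0 ∧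
      ∀ t ∈ Ioo 0 T, y t < 0 := by
  set w : ℝ := √(1 - b ^ 2) with hw
  have hb2 : 0 < 1 - b ^ 2 := by nlinarith
  have hw0 : 0 < w := Real.sqrt_pos.2 hb2
  have hw2 : w ^ 2 = 1 - b ^ 2 := Real.sq_sqrt hb2.le
  set y : ℝ → ℝ := fun t => a * (exp (b * t) * (cos (w * t) - b / w * sin (w * t)) - 1) with hy
  set v : ℝ → ℝ := fun t => -(a / w) * (exp (b * t) * sin (w * t)) with hv
  have hexp : ∀ t, HasDerivAt (fun t => exp (b * t)) (exp (b * t) * b) t := fun t => by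
    simpa using ((hasDerivAt_id t).const_mul b).exp
  have hsin : ∀ t, HasDerivAt (fun t => sin (w * t)) (cos (w * t) * w) t := fun t => by
    simpa using ((hasDerivAt_id t).const_mul w).sin
  have hcos : ∀ t, HasDerivAt (fun t => cos (w * t)) (-sin (w * t) * w) t := fun t => by
    simpa using ((hasDerivAt_id t).const_mul w).cos
  have hdy : ∀ t, HasDerivAt y (v t) t := fun t => by
    refine (((hexp t).mul ((hcos t).sub ((hsin t).const_mul (b / w)))).sub_const 1
      |>.const_mul a).congr_deriv ?_
    simp only [hv, Pi.sub_apply]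
    field_simp
    linear_combination (-sin (t * w)) * hw2
  have hdv : ∀ t, HasDerivAt v (2 * b * v t - y t - a) t := fun t => by
    refine (((hexp t).mul (hsin t)).const_mul (-(a / w))).congr_deriv ?_
    simp only [hv, hy]
    field_simp
    ring
  set T₁ : ℝ := π / w with hT₁
  have hT₁0 : 0 < T₁ := by positivity
  have hwT : w * T₁ = π := by rw [hT₁]; field_simp
  have hv1 : ∀ t ∈ Ioo 0 T₁, v t < 0 := fun t ht => by
    have : 0 < sin (w * t) := sin_pos_of_pos_of_lt_pi (mul_pos hw0 ht.1)
      (by rw [← hwT]; exact mul_lt_mul_of_pos_left ht.2 hw0)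
    have h2 : 0 < a / w * (exp (b * t) * sin (w * t)) := by positivity
    simp only [hv]; linarith
  have hv2 : ∀ t ∈ Ioo T₁ (2 * T₁), 0 < v t := fun t ht => by
    have : sin (w * t) < 0 := by
      rw [← sin_sub_two_pi]
      refine sin_neg_of_neg_of_neg_pi_lt ?_ ?_
      · have := mul_lt_mul_of_pos_left ht.2 hw0; nlinarith
      · have := mul_lt_mul_of_pos_left ht.1 hw0; nlinarith
    have h2 : 0 < a / w * (exp (b * t) * -sin (w * t)) := by
      have := neg_pos.2 this; positivity
    simp only [hv]; linarith
  have hycont : Continuous y := continuous_iff_continuousAt.2 fun t => (hdy t).continuousAt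
  have hy0 : y 0 = 0 := by simp [hy]
  have hanti : StrictAntiOn y (Icc 0 T₁) := by
    refine strictAntiOn_of_deriv_neg (convex_Icc _ _) hycont.continuousOn fun t ht => ?_
    rw [interior_Icc] at ht
    rw [(hdy t).deriv]; exact hv1 t ht
  have hmono : StrictMonoOn y (Icc T₁ (2 * T₁)) := by
    refine strictMonoOn_of_deriv_pos (convex_Icc _ _) hycont.continuousOn fun t ht => ?_
    rw [interior_Icc] at ht
    rw [(hdy t).deriv]; exact hv2 t ht
  have hyT₁ : y T₁ < 0 := by
    rw [← hy0]; exact hanti ⟨le_rfl, hT₁0.le⟩ ⟨hT₁0.le, le_rfl⟩ hT₁0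
  have hyT₂ : 0 < y (2 * T₁) := by
    have : w * (2 * T₁) = 2 * π := by rw [← hwT]; ring
    simp only [hy, this, cos_two_pi, sin_two_pi]
    have : 1 < exp (b * (2 * T₁)) := Real.one_lt_exp_iff.2 (by positivity)
    have : 0 < exp (b * (2 * T₁)) * (1 - b / w * 0) - 1 := by linarith
    positivity
  obtain ⟨T, hT, hyT⟩ := intermediate_value_Ioo (by linarith : T₁ ≤ 2 * T₁) hycont.continuousOn
    (show (0 : ℝ) ∈ Ioo (y T₁) (y (2 * T₁)) from ⟨hyT₁, hyT₂⟩)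
  refine ⟨fun t => 2 * b * y t - v t, y, T, hT₁0.trans hT.1, fun t => ?_, fun t => ?_, ?_, hy0,
    hyT, ?_, fun t ht => ?_⟩
  · exact (((hdy t).const_mul (2 * b)).sub (hdv t)).congr_deriv (by ring)
  · exact (hdy t).congr_deriv (by ring)
  · simp [hy0, hv]
  · have := hv2 T hT
    simp only [hyT]; linarith
  · rcases le_total t T₁ with h | h
    · rw [← hy0]; exact hanti ⟨le_rfl, hT₁0.le⟩ ⟨ht.1.le, h⟩ ht.1
    · rw [← hyT]; exact hmono ⟨h, (ht.2.trans hT.2).le⟩ ⟨hT.1.le, hT.2.le⟩ ht.2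

end Reference

section UpperArc

open Set

/-- Quantitative bounds on the damping function `g` of the planar system
`ẋ = y + a, ẏ = -x + g y`. -/
structure DampingBounds (g : ℝ → ℝ) (a b e κ η N Λ Q : ℝ) : Prop where
  lipschitz : ∃ K, LipschitzWith K g
  le_small : ∀ y, g y ≤ e
  linear_le : ∀ y ≤ 0, 2 * b * y ≤ g y
  le_linear : ∀ y ≤ 0, g y ≤ 2 * b * y + e
  one_sided : ∀ y z, (y - z) * (g y - g z) ≤ 3 * (y - z) ^ 2
  small_le : ∀ y, 0 ≤ y → y ≤ κ → -e ≤ g y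
  strong : ∀ y, η ≤ y → g y ≤ -N
  expand : ∀ y z, -(a / 2) ≤ y → -(a / 2) ≤ z → y ≤ η → z ≤ η →
    (y - z) * (g y / (y + a) - g z / (z + a)) ≤ Λ * (y - z) ^ 2
  contract : ∀ y z, κ ≤ y → κ ≤ z → y ≤ η → z ≤ η →
    (y - z) * (g y / (y + a) - g z / (z + a)) ≤ -Q * (y - z) ^ 2
  mono : ∀ y ≤ 0, b * (y + a) ^ 2 ≤ (y + a) * (g y - g (-a))

/-- The constants of the construction are compatible. -/
structure ArcConstants (a b c δ e κ η R N Λ Q : ℝ) : Prop where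
  a_pos : 0 < a
  b_pos : 0 < b
  b_lt : b < 1
  c_pos : 0 < c
  c_le : c ≤ a / 4
  δ_pos : 0 < δ
  δ_le_a : δ ≤ a / 4
  δ_le_c : 8 * δ ≤ c
  e_pos : 0 < e
  e_le_one : e ≤ 1
  e_le_c : 8 * e ≤ c
  κ_pos : 0 < κ
  κ_le_a : κ ≤ a
  small : 2 * δ + κ < c ^ 2 / (4 * a)
  η_pos : 0 < η
  η_le_a : η ≤ a / 2
  R_pos : 0 < R
  R_lt_N : R < N
  Λ_nonneg : 0 ≤ Λ
  Q_nonneg : 0 ≤ Q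

/-- A piece of trajectory above the line `y = -a / 2` written as a graph over `[x₀, 0]`. -/
structure UpperArc (g : ℝ → ℝ) (a c δ κ η x₀ : ℝ) (U : ℝ → ℝ) : Prop where
  hasDerivAt : ∀ x ∈ Icc x₀ 0, HasDerivAt U ((-x + g (U x)) / (U x + a)) x
  ge_half : ∀ x ∈ Icc x₀ 0, -(a / 2) ≤ U x
  le_top : ∀ x ∈ Icc x₀ 0, U x ≤ η
  ge_start : ∀ x ∈ Icc x₀ (-c), -(2 * δ) ≤ U x
  ge_slow : ∀ x ∈ Icc (-c) (-(c / 2)), κ ≤ U x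
  ge_end : -η ≤ U 0

variable {g : ℝ → ℝ} {a b c δ e κ η R N Λ Q : ℝ}

lemma upperArc_of_regularized (hg : DampingBounds g a b e κ η N Λ Q)
    (hC : ArcConstants a b c δ e κ η R N Λ Q) {x₀ : ℝ} (hx₀ : x₀ ≤ -(2 * c)) (hR : -R ≤ x₀)
    {U ξ : ℝ → ℝ} (hξ₀ : ξ x₀ = x₀)
    (hξ : ∀ x, HasDerivAt ξ ((U x + a) / max (U x + a) (a / 2)) x)
    (hU : ∀ x, HasDerivAt U ((-ξ x + g (U x)) / max (U x + a) (a / 2)) x)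
    (hU0 : -(2 * δ) ≤ U x₀) (hU0' : U x₀ ≤ 0) :
    UpperArc g a c δ κ η x₀ U ∧ ∀ x ∈ Icc x₀ 0, ξ x = x := by
  obtain ⟨a_pos, b_pos, b_lt, c_pos, c_le, δ_pos, δ_le_a, δ_le_c, e_pos, e_le_one, e_le_c, κ_pos,
    κ_le_a, small, η_pos, η_le_a, R_pos, R_lt_N, -, -⟩ := hC
  have hm : ∀ u : ℝ, 0 < max (u + a) (a / 2) := fun u => lt_max_of_lt_right (by linarith)
  have hξle : ∀ x ∈ Icc x₀ 0, ξ x ≤ x := by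
    intro x hx
    have := sub_le_mul_of_deriv_le (f := ξ) (k := 1) hx.1 (fun t _ => hξ t)
      (fun t _ => (div_le_one (hm _)).2 (le_max_left _ _))
    linarith
  have low1 : ∀ x ∈ Icc x₀ (-c), -(2 * δ) + (2 * δ + κ) / (-c - x₀) * (x - x₀) ≤ U x := by
    refine line_le_of_lt_deriv (fun t _ => hU t) hU0 fun x hx he => ?_
    have hden : c ≤ -c - x₀ := by linarith
    have hden0 : 0 < -c - x₀ := by linarith
    have h1 : (2 * δ + κ) / (-c - x₀) * (x - x₀) ≤ 2 * δ + κ := by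
      rw [div_mul_eq_mul_div, div_le_iff₀ hden0]
      have : x - x₀ ≤ -c - x₀ := by linarith [hx.2]
      nlinarith
    have h2 : 0 ≤ (2 * δ + κ) / (-c - x₀) * (x - x₀) :=
      mul_nonneg (by positivity) (by linarith [hx.1])
    have hgl : -(c / 2) ≤ g (U x) := by
      rcases le_total (U x) 0 with h | h
      · have := hg.linear_le _ h
        have h3 : -(2 * δ) ≤ U x := by linarith
        nlinarith
      · have := hg.small_le _ h (by linarith)
        linarith
    have hnum : c / 2 ≤ -ξ x + g (U x) := by
      have := hξle x ⟨hx.1, by linarith [hx.2]⟩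
      linarith [hx.2]
    have hmx : max (U x + a) (a / 2) ≤ 2 * a := max_le (by linarith) (by linarith)
    calc (2 * δ + κ) / (-c - x₀) ≤ (2 * δ + κ) / c := by gcongr
      _ < (c ^ 2 / (4 * a)) / c := by gcongr
      _ = (c / 2) / (2 * a) := by field_simp; norm_num
      _ ≤ (-ξ x + g (U x)) / max (U x + a) (a / 2) :=
        div_le_div₀ (by linarith) hnum (hm _) hmx
  have low1' : ∀ x ∈ Icc x₀ (-c), -(2 * δ) ≤ U x := fun x hx => by
    have h2 : 0 ≤ (2 * δ + κ) / (-c - x₀) * (x - x₀) :=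
      mul_nonneg (div_nonneg (by linarith) (by linarith)) (by linarith [hx.1])
    linarith [low1 x hx]
  have low2 : ∀ x ∈ Icc (-c) (-(c / 2)), κ ≤ U x := by
    have hstart : κ ≤ U (-c) := by
      have := low1 (-c) ⟨by linarith, le_rfl⟩
      rw [div_mul_cancel₀ _ (by linarith)] at this
      linarith
    intro x hx
    have := line_le_of_lt_deriv (k := 0) (fun t _ => hU t) hstart (fun x hx he => ?_) x hx
    · linarith
    · have hUx : U x = κ := by linarith
      have h1 := hg.small_le (U x) (by linarith) hUx.le
      have h2 := hξle x ⟨by linarith [hx.1], by linarith [hx.2]⟩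
      exact div_pos (by linarith [hx.2]) (hm _)
  have low3 : ∀ x ∈ Icc (-(c / 2)) 0, -η ≤ U x := by
    have hstart : 0 ≤ U (-(c / 2)) := κ_pos.le.trans (low2 _ ⟨by linarith, le_rfl⟩)
    intro x hx
    have hbound : ∀ x ∈ Icc (-(c / 2)) 0, -η ≤ 0 + -(2 * η / c) * (x - -(c / 2)) := by
      intro x hx
      have : 2 * η / c * (x - -(c / 2)) ≤ 2 * η / c * (c / 2) := by
        gcongr; linarith [hx.2]
      have h2 : 2 * η / c * (c / 2) = η := by field_simp
      linarith
    have := line_le_of_lt_deriv (k := -(2 * η / c)) (fun t _ => hU t) hstart (fun x hx he => ?_)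
      x hx
    · linarith [hbound x hx]
    · have h0 : U x ≤ 0 := by
        have : 0 ≤ 2 * η / c * (x - -(c / 2)) := mul_nonneg (by positivity) (by linarith [hx.1])
        linarith
      have h1 : -η ≤ U x := by linarith [hbound x hx]
      have h2 := hξle x ⟨by linarith [hx.1], hx.2⟩
      have h3 := hg.linear_le _ h0
      have hnum : -(2 * b * η) ≤ -ξ x + g (U x) := by nlinarith [hx.2]
      rw [lt_div_iff₀ (hm _)]
      have hmx : a / 2 ≤ max (U x + a) (a / 2) := le_max_right _ _
      have h4 : 2 * η / c * (a / 2) ≤ 2 * η / c * max (U x + a) (a / 2) := by gcongr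
      have h5 : 4 * η ≤ 2 * η / c * (a / 2) := by
        rw [div_mul_eq_mul_div, le_div_iff₀ c_pos]; nlinarith
      nlinarith
  have half : ∀ x ∈ Icc x₀ 0, -(a / 2) ≤ U x := by
    intro x hx
    rcases le_total x (-c) with h | h
    · linarith [low1' x ⟨hx.1, h⟩]
    · rcases le_total x (-(c / 2)) with h' | h'
      · linarith [low2 x ⟨h, h'⟩]
      · linarith [low3 x ⟨h', hx.2⟩]
  have hmax : ∀ x ∈ Icc x₀ 0, max (U x + a) (a / 2) = U x + a := fun x hx =>
    max_eq_left (by linarith [half x hx])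
  have hξeq : ∀ x ∈ Icc x₀ 0, ξ x = x := by
    intro x hx
    refine le_antisymm (hξle x hx) ?_
    have := mul_le_sub_of_le_deriv (f := ξ) (k := 1) hx.1 (fun t _ => hξ t) (fun t ht => ?_)
    · linarith
    · have ht' : t ∈ Icc x₀ 0 := ⟨ht.1, ht.2.trans hx.2⟩
      have := half t ht'
      rw [hmax t ht', div_self (by linarith)]
  have hder : ∀ x ∈ Icc x₀ 0, HasDerivAt U ((-x + g (U x)) / (U x + a)) x := fun x hx => by
    have := hU x
    rwa [hmax x hx, hξeq x hx] at this
  refine ⟨⟨hder, half, fun x hx => ?_, low1', low2, low3 0 ⟨by linarith, le_rfl⟩⟩, hξeq⟩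
  have := le_line_of_deriv_lt (A := η) (k := 0) hder (by linarith) (fun t ht he => ?_) x hx
  · linarith
  · have h1 := hg.strong (U t) (by linarith)
    exact div_neg_of_neg_of_pos (by linarith [ht.1]) (by linarith [half t ht])

/-- Along an upper arc the slope is at most `2 (R + 1) / a`. -/
lemma UpperArc.sub_le (hg : DampingBounds g a b e κ η N Λ Q)
    (hC : ArcConstants a b c δ e κ η R N Λ Q) {x₀ : ℝ} {U : ℝ → ℝ}
    (hU : UpperArc g a c δ κ η x₀ U) (hR : -R ≤ x₀) {x : ℝ} (hx : x ∈ Icc x₀ 0) :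
    U x - U x₀ ≤ 2 * (R + 1) / a * (x - x₀) := by
  refine sub_le_mul_of_deriv_le hx.1
    (fun t ht => hU.hasDerivAt t ⟨ht.1, ht.2.trans hx.2⟩) fun t ht => ?_
  have h1 := hU.ge_half t ⟨ht.1, ht.2.trans hx.2⟩
  have ha := hC.a_pos
  have hR0 := hC.R_pos
  have hpos : 0 < U t + a := by linarith
  have h2 := hg.le_small (U t)
  rw [div_le_iff₀ hpos]
  have h3 : 2 * (R + 1) / a * (a / 2) = R + 1 := by field_simp
  have h4 : 2 * (R + 1) / a * (a / 2) ≤ 2 * (R + 1) / a * (U t + a) := by gcongr; linarith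
  linarith [ht.1, hC.e_le_one]

/-- While it stays in `y ≤ 0`, an upper arc increases initially. -/
lemma UpperArc.nonneg_sub (hg : DampingBounds g a b e κ η N Λ Q)
    (hC : ArcConstants a b c δ e κ η R N Λ Q) {x₀ : ℝ} {U : ℝ → ℝ}
    (hU : UpperArc g a c δ κ η x₀ U) {x : ℝ} (hx : x ∈ Icc x₀ (-c))
    (hneg : ∀ t ∈ Icc x₀ x, U t ≤ 0) : 0 ≤ U x - U x₀ := by
  have hc := hC.c_pos
  have := mul_le_sub_of_le_deriv (k := 0) hx.1
    (fun t ht => hU.hasDerivAt t ⟨ht.1, by linarith [ht.2, hx.2]⟩) fun t ht => ?_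
  · linarith
  have h1 := hU.ge_half t ⟨ht.1, by linarith [ht.2, hx.2]⟩
  have h2 := hg.linear_le _ (hneg t ht)
  have h3 := hU.ge_start t ⟨ht.1, ht.2.trans hx.2⟩
  have ha := hC.a_pos
  refine div_nonneg ?_ (by linarith)
  nlinarith [hC.δ_le_c, hC.b_lt, hC.b_pos, hC.δ_pos, ht.2, hx.2]

lemma UpperArc.sq_sub_le (hg : DampingBounds g a b e κ η N Λ Q)
    (hC : ArcConstants a b c δ e κ η R N Λ Q) {x₀ x₁ x₂ : ℝ} {U W : ℝ → ℝ}
    (hU : UpperArc g a c δ κ η x₁ U) (hW : UpperArc g a c δ κ η x₂ W)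
    (h1 : x₁ ≤ x₀) (h2 : x₂ ≤ x₀) (hR : -R ≤ x₀) (hx₀ : x₀ ≤ -c) :
    (U 0 - W 0) ^ 2 ≤ (U x₀ - W x₀) ^ 2 * Real.exp (2 * Λ * R - Q * c) := by
  have hc := hC.c_pos
  have hder : ∀ x ∈ Icc x₀ 0, HasDerivAt (fun x => (U x - W x) ^ 2)
      (2 * ((U x - W x) * ((-x + g (U x)) / (U x + a) - (-x + g (W x)) / (W x + a)))) x := by
    intro x hx
    refine (((hU.hasDerivAt x ⟨h1.trans hx.1, hx.2⟩).sub
      (hW.hasDerivAt x ⟨h2.trans hx.1, hx.2⟩)).pow 2).congr_deriv ?_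
    simp only [Pi.sub_apply]
    push_cast
    ring
  have key : ∀ x ∈ Icc x₀ 0, ∀ q, (U x - W x) * (g (U x) / (U x + a) - g (W x) / (W x + a))
      ≤ q * (U x - W x) ^ 2 →
      2 * ((U x - W x) * ((-x + g (U x)) / (U x + a) - (-x + g (W x)) / (W x + a)))
      ≤ 2 * q * (U x - W x) ^ 2 := by
    intro x hx q hq
    have hu := hU.ge_half x ⟨h1.trans hx.1, hx.2⟩
    have hw := hW.ge_half x ⟨h2.trans hx.1, hx.2⟩
    have ha := hC.a_pos
    have hu' : 0 < U x + a := by linarith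
    have hw' : 0 < W x + a := by linarith
    have e1 : (-x + g (U x)) / (U x + a) - (-x + g (W x)) / (W x + a)
        = (g (U x) / (U x + a) - g (W x) / (W x + a))
          - (-x) * (U x - W x) / ((U x + a) * (W x + a)) := by
      field_simp
      ring
    have e2 : 0 ≤ (U x - W x) * ((-x) * (U x - W x) / ((U x + a) * (W x + a))) := by
      have : (U x - W x) * ((-x) * (U x - W x) / ((U x + a) * (W x + a)))
          = (-x) * (U x - W x) ^ 2 / ((U x + a) * (W x + a)) := by ring
      rw [this]
      have hx0 : 0 ≤ -x := by linarith [hx.2]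
      positivity
    rw [e1, mul_sub]
    linarith
  have hexp : ∀ x ∈ Icc x₀ 0, (U x - W x) * (g (U x) / (U x + a) - g (W x) / (W x + a))
      ≤ Λ * (U x - W x) ^ 2 := fun x hx =>
    hg.expand _ _ (hU.ge_half x ⟨h1.trans hx.1, hx.2⟩) (hW.ge_half x ⟨h2.trans hx.1, hx.2⟩)
      (hU.le_top x ⟨h1.trans hx.1, hx.2⟩) (hW.le_top x ⟨h2.trans hx.1, hx.2⟩)
  have s1 := le_mul_exp_of_deriv_le (K := 2 * Λ) hx₀
    (fun x hx => hder x ⟨hx.1, by linarith [hx.2]⟩)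
    (fun x hx => key x ⟨hx.1, by linarith [hx.2]⟩ _ (hexp x ⟨hx.1, by linarith [hx.2]⟩))
  have s2 := le_mul_exp_of_deriv_le (K := 2 * -Q) (t₀ := -c) (t₁ := -(c / 2)) (by linarith)
    (fun x hx => hder x ⟨hx₀.trans hx.1, by linarith [hx.2]⟩)
    (fun x hx => key x ⟨hx₀.trans hx.1, by linarith [hx.2]⟩ _
      (hg.contract _ _ (hU.ge_slow x hx) (hW.ge_slow x hx)
        (hU.le_top x ⟨by linarith [hx.1], by linarith [hx.2]⟩)
        (hW.le_top x ⟨by linarith [hx.1], by linarith [hx.2]⟩)))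
  have s3 := le_mul_exp_of_deriv_le (K := 2 * Λ) (t₀ := -(c / 2)) (t₁ := 0) (by linarith)
    (fun x hx => hder x ⟨by linarith [hx.1], hx.2⟩)
    (fun x hx => key x ⟨by linarith [hx.1], hx.2⟩ _ (hexp x ⟨by linarith [hx.1], hx.2⟩))
  have hmul : ∀ {A B C p q r : ℝ}, A ≤ B * Real.exp p → B ≤ C * Real.exp q → C ≤ r →
      A ≤ r * Real.exp (q + p) := by
    intro A B C p q r hA hB hCr
    calc A ≤ B * Real.exp p := hA
      _ ≤ (C * Real.exp q) * Real.exp p := by gcongr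
      _ ≤ (r * Real.exp q) * Real.exp p := by gcongr
      _ = r * Real.exp (q + p) := by rw [Real.exp_add]; ring
  have s23 := hmul s3 s2 le_rfl
  have s123 := hmul s23 s1 le_rfl
  refine s123.trans ?_
  gcongr
  nlinarith [hC.Λ_nonneg, hC.Q_nonneg]

end UpperArc

section PlanarTrajectories

open Set

/-- The vector field of the Liénard type system `ẋ = y + a, ẏ = -x + g y`. -/
def planarField (g : ℝ → ℝ) (a : ℝ) (z : ℝ × ℝ) : ℝ × ℝ :=
  (z.2 + a, -z.1 + g z.2)

/-- `p` is a global trajectory of `planarField g a`. -/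
def IsTrajectory (g : ℝ → ℝ) (a : ℝ) (p : ℝ → ℝ × ℝ) : Prop :=
  ∀ t, HasDerivAt p (planarField g a (p t)) t

variable {g : ℝ → ℝ} {a : ℝ} {p q : ℝ → ℝ × ℝ}

lemma IsTrajectory.fst (hp : IsTrajectory g a p) (t : ℝ) :
    HasDerivAt (fun t => (p t).1) ((p t).2 + a) t :=
  (hasFDerivAt_fst.comp_hasDerivAt t (hp t) :)

lemma IsTrajectory.snd (hp : IsTrajectory g a p) (t : ℝ) :
    HasDerivAt (fun t => (p t).2) (-(p t).1 + g (p t).2) t :=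
  (hasFDerivAt_snd.comp_hasDerivAt t (hp t) :)

lemma IsTrajectory.continuous (hp : IsTrajectory g a p) : Continuous p :=
  continuous_iff_continuousAt.2 fun t => (hp t).continuousAt

lemma IsTrajectory.shift (hp : IsTrajectory g a p) (s : ℝ) :
    IsTrajectory g a fun t => p (t + s) := fun t => (hp (t + s)).comp_add_const t s

lemma lipschitzWith_planarField {K : NNReal} (hg : LipschitzWith K g) (a : ℝ) :
    ∃ K', LipschitzWith K' (planarField g a) := by
  have h1 : LipschitzWith 1 fun z : ℝ × ℝ => z.2 + a := by
    refine LipschitzWith.of_dist_le_mul fun z w => ?_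
    simpa using LipschitzWith.prod_snd.dist_le_mul z w
  have h2 : LipschitzWith (1 + K * 1) fun z : ℝ × ℝ => -z.1 + g z.2 :=
    (LipschitzWith.prod_fst.neg).add (hg.comp LipschitzWith.prod_snd)
  exact ⟨_, h1.prodMk h2⟩

lemma IsTrajectory.eq_of_eq {K : NNReal} (hg : LipschitzWith K g) (hp : IsTrajectory g a p)
    (hq : IsTrajectory g a q) {s : ℝ} (h : p s = q s) : p = q := by
  obtain ⟨K', hK⟩ := lipschitzWith_planarField hg a
  exact integral_curve_unique hK hp hq h

/-- The square of the Euclidean distance in the plane. -/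
def sqDist (z w : ℝ × ℝ) : ℝ := (z.1 - w.1) ^ 2 + (z.2 - w.2) ^ 2

lemma sqDist_nonneg (z w : ℝ × ℝ) : 0 ≤ sqDist z w := by unfold sqDist; positivity

lemma abs_fst_sub_le_of_sqDist_le {z w : ℝ × ℝ} {d : ℝ} (hd : 0 ≤ d) (h : sqDist z w ≤ d ^ 2) :
    |z.1 - w.1| ≤ d := by
  unfold sqDist at h
  exact abs_le_of_sq_le_sq (by nlinarith [sq_nonneg (z.2 - w.2)]) hd

lemma abs_snd_sub_le_of_sqDist_le {z w : ℝ × ℝ} {d : ℝ} (hd : 0 ≤ d) (h : sqDist z w ≤ d ^ 2) :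
    |z.2 - w.2| ≤ d := by
  unfold sqDist at h
  exact abs_le_of_sq_le_sq (by nlinarith [sq_nonneg (z.1 - w.1)]) hd

lemma dist_le_of_sqDist_le {z w : ℝ × ℝ} {d : ℝ} (hd : 0 ≤ d) (h : sqDist z w ≤ d ^ 2) :
    dist z w ≤ d := by
  rw [Prod.dist_eq, Real.dist_eq, Real.dist_eq]
  exact max_le (abs_fst_sub_le_of_sqDist_le hd h) (abs_snd_sub_le_of_sqDist_le hd h)

lemma sqDist_le_two_mul_dist_sq (z w : ℝ × ℝ) : sqDist z w ≤ 2 * dist z w ^ 2 := by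
  have h1 : |z.1 - w.1| ≤ dist z w := by
    rw [Prod.dist_eq, Real.dist_eq]; exact le_max_left _ _
  have h2 : |z.2 - w.2| ≤ dist z w := by
    rw [Prod.dist_eq, Real.dist_eq (z.2)]; exact le_max_right _ _
  have h3 := sq_le_sq' (by linarith [abs_nonneg (z.1 - w.1)]) h1
  have h4 := sq_le_sq' (by linarith [abs_nonneg (z.2 - w.2)]) h2
  rw [sq_abs] at h3 h4
  unfold sqDist; linarith

lemma IsTrajectory.sqDist_le (hg : ∀ y z, (y - z) * (g y - g z) ≤ 3 * (y - z) ^ 2)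
    (hp : IsTrajectory g a p) (hq : IsTrajectory g a q) {t : ℝ} (ht : 0 ≤ t) :
    sqDist (p t) (q t) ≤ sqDist (p 0) (q 0) * Real.exp (6 * t) := by
  have := le_mul_exp_of_deriv_le (f := fun t => sqDist (p t) (q t)) (K := 6) ht
    (fun t _ => (((hp.fst t).sub (hq.fst t)).pow 2).add (((hp.snd t).sub (hq.snd t)).pow 2))
    (fun t _ => ?_)
  · simpa using this
  · have := hg (p t).2 (q t).2
    simp only [sqDist, Pi.sub_apply]
    push_cast
    nlinarith [sq_nonneg ((p t).1 - (q t).1)]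

lemma IsTrajectory.dist_le (hg : ∀ y z, (y - z) * (g y - g z) ≤ 3 * (y - z) ^ 2)
    (hp : IsTrajectory g a p) (hq : IsTrajectory g a q) {t : ℝ} (ht : 0 ≤ t) :
    dist (p t) (q t) ≤ 2 * Real.exp (3 * t) * dist (p 0) (q 0) := by
  have h1 := hp.sqDist_le hg hq ht
  have h2 := sqDist_le_two_mul_dist_sq (p 0) (q 0)
  refine dist_le_of_sqDist_le (by positivity) ?_
  have h3 : Real.exp (6 * t) = Real.exp (3 * t) ^ 2 := by
    rw [← Real.exp_nat_mul]; congr 1; push_cast; ring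
  rw [h3] at h1
  nlinarith [mul_le_mul_of_nonneg_right h2 (sq_nonneg (Real.exp (3 * t))),
    mul_nonneg (sq_nonneg (Real.exp (3 * t))) (sq_nonneg (dist (p 0) (q 0)))]

/-- Comparison with a trajectory of the linear system in the lower half plane. -/
lemma IsTrajectory.sqDist_linear_le {b e T : ℝ}
    (hg : ∀ y z, (y - z) * (g y - g z) ≤ 3 * (y - z) ^ 2)
    (hlo : ∀ y ≤ 0, 2 * b * y ≤ g y) (hhi : ∀ y ≤ 0, g y ≤ 2 * b * y + e)
    (hp : IsTrajectory g a p) {x y : ℝ → ℝ} (hx : ∀ t, HasDerivAt x (y t + a) t)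
    (hy : ∀ t, HasDerivAt y (-x t + 2 * b * y t) t) (hy0 : ∀ t ∈ Icc 0 T, y t ≤ 0) {t : ℝ}
    (ht : t ∈ Icc 0 T) :
    sqDist (p t) (x t, y t) + e ^ 2 ≤ (sqDist (p 0) (x 0, y 0) + e ^ 2) * Real.exp (7 * t) := by
  have := le_mul_exp_of_deriv_le (f := fun t => sqDist (p t) (x t, y t) + e ^ 2) (K := 7) ht.1
    (fun t _ => ((((hp.fst t).sub (hx t)).pow 2).add (((hp.snd t).sub (hy t)).pow 2)).add_const _)
    (fun s hs => ?_)
  · simpa using this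
  · have hs0 := hy0 s ⟨hs.1, hs.2.trans ht.2⟩
    have h1 := hg (p s).2 (y s)
    have h2 := hlo _ hs0
    have h3 := hhi _ hs0
    have h4 : 2 * ((p s).2 - y s) * (g (y s) - 2 * b * y s) ≤
        ((p s).2 - y s) ^ 2 + (g (y s) - 2 * b * y s) ^ 2 := by
      nlinarith [sq_nonneg (((p s).2 - y s) - (g (y s) - 2 * b * y s))]
    have h5 : (g (y s) - 2 * b * y s) ^ 2 ≤ e ^ 2 := pow_le_pow_left₀ (by linarith) (by linarith) 2
    simp only [sqDist, Pi.sub_apply]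
    push_cast
    nlinarith [sq_nonneg ((p s).1 - x s), sq_nonneg e]

end PlanarTrajectories

section ReturnMap

open Set

variable {g : ℝ → ℝ} {a b c δ e κ η R N Λ Q σ ρ T : ℝ} {p q : ℝ → ℝ × ℝ} {x y : ℝ → ℝ}

lemma IsTrajectory.exists_upperArc (hg : DampingBounds g a b e κ η N Λ Q)
    (hC : ArcConstants a b c δ e κ η R N Λ Q) (hp : IsTrajectory g a p) {t₁ : ℝ}
    (h1 : (p t₁).1 ≤ -(2 * c)) (h2 : -R ≤ (p t₁).1) (h3 : -(2 * δ) ≤ (p t₁).2)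
    (h4 : (p t₁).2 ≤ 0) :
    ∃ U T₂, UpperArc g a c δ κ η (p t₁).1 U ∧ U (p t₁).1 = (p t₁).2 ∧ t₁ ≤ T₂ ∧
      T₂ ≤ t₁ + 2 * R / a ∧ p T₂ = (0, U 0) ∧
      ∀ t ∈ Icc t₁ T₂, ∃ x ∈ Icc (p t₁).1 0, p t = (x, U x) := by
  have ha := hC.a_pos
  have hc := hC.c_pos
  obtain ⟨τ, hτ0, hτ⟩ := exists_time_change (u := fun t => max ((p t).2 + a) (a / 2))
    (by have := hp.continuous; fun_prop) (half_pos ha) (fun t => le_max_right _ _) t₁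
  set x₀ := (p t₁).1 with hx₀
  have hd : ∀ x, HasDerivAt (fun x => τ (x - x₀))
      (max ((p (τ (x - x₀))).2 + a) (a / 2))⁻¹ x := fun x => (hτ (x - x₀)).comp_sub_const x x₀
  have hξ : ∀ x, HasDerivAt (fun x => (p (τ (x - x₀))).1)
      (((p (τ (x - x₀))).2 + a) / max ((p (τ (x - x₀))).2 + a) (a / 2)) x := fun x => by
    rw [div_eq_mul_inv]; exact (hp.fst _).comp x (hd x)
  have hU : ∀ x, HasDerivAt (fun x => (p (τ (x - x₀))).2)
      ((-(p (τ (x - x₀))).1 + g (p (τ (x - x₀))).2) /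
        max ((p (τ (x - x₀))).2 + a) (a / 2)) x := fun x => by
    rw [div_eq_mul_inv]; exact (hp.snd _).comp x (hd x)
  have hstart : p (τ (x₀ - x₀)) = p t₁ := by rw [sub_self, hτ0]
  obtain ⟨hA, hid⟩ := upperArc_of_regularized hg hC h1 h2 (ξ := fun x => (p (τ (x - x₀))).1)
    (by simp only [hstart]; rfl) hξ hU (by simpa only [hstart] using h3)
    (by simpa only [hstart] using h4)
  have hx0 : x₀ ≤ 0 := by linarith
  have hpos : ∀ x, 0 ≤ (max ((p (τ (x - x₀))).2 + a) (a / 2))⁻¹ := fun x =>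
    inv_nonneg.2 (le_max_of_le_right (half_pos ha).le)
  have hle : ∀ x, (max ((p (τ (x - x₀))).2 + a) (a / 2))⁻¹ ≤ 2 / a := fun x => by
    exact (inv_anti₀ (half_pos ha) (le_max_right _ _)).trans_eq (inv_div _ _)
  have hi := mul_le_sub_of_le_deriv (k := 0) hx0 (fun x _ => hd x) (fun x _ => hpos x)
  have hj := sub_le_mul_of_deriv_le (k := 2 / a) hx0 (fun x _ => hd x) (fun x _ => hle x)
  simp only [sub_self, hτ0] at hi hj
  refine ⟨_, τ (0 - x₀), hA, by simp only [hstart], by linarith, ?_, ?_, ?_⟩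
  · have : 2 / a * (0 - x₀) ≤ 2 * R / a := by
      rw [div_mul_eq_mul_div]; gcongr; linarith
    linarith
  · exact Prod.ext (hid 0 ⟨hx0, le_rfl⟩) rfl
  · intro t ht
    have hcont : ContinuousOn (fun x => τ (x - x₀)) (Icc x₀ 0) :=
      fun x _ => (hd x).continuousAt.continuousWithinAt
    have := intermediate_value_Icc hx0 hcont
    simp only [sub_self, hτ0] at this
    obtain ⟨x, hx, hxt⟩ := this ht
    exact ⟨x, hx, Prod.ext (by rw [← hxt]; exact hid x hx) (by rw [← hxt])⟩

/-- A trajectory of the linear system in the lower half plane, with the tolerances `ρ` (at the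
beginning) and `σ` (all along) for its comparison with other trajectories. -/
structure LowerArc (a b c δ e σ ρ R T : ℝ) (x y : ℝ → ℝ) : Prop where
  T_pos : 0 < T
  hasDerivAt_x : ∀ t, HasDerivAt x (y t + a) t
  hasDerivAt_y : ∀ t, HasDerivAt y (-x t + 2 * b * y t) t
  x_zero : x 0 = 0
  y_zero : y 0 = 0
  nonpos : ∀ t ∈ Icc 0 T, y t ≤ 0
  x_bound : ∀ t ∈ Icc 0 T, |x t| + σ ≤ R
  y_bound : ∀ t ∈ Icc 0 T, |y t| + σ ≤ R
  x_end : x T + σ ≤ -(2 * c)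
  y_end_le : y T + σ + 2 * (R + 1) / a * (2 * σ) ≤ 0
  le_y_end : -(2 * δ) ≤ y T - σ
  a_le : a ≤ R
  σ_pos : 0 < σ
  ρ_pos : 0 < ρ
  growth : (2 * ρ ^ 2 + e ^ 2) * Real.exp (7 * T) ≤ σ ^ 2

/-- The trajectory `p` follows the lower arc `(x, y)` until time `T`, then the upper arc `U`
until it meets the `y`-axis at time `T₂`. -/
structure ReturnArc (g : ℝ → ℝ) (a c δ κ η R σ T xT yT : ℝ) (p : ℝ → ℝ × ℝ) (T₂ : ℝ)
    (U : ℝ → ℝ) : Prop where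
  upper : UpperArc g a c δ κ η (p T).1 U
  start : U (p T).1 = (p T).2
  le_time : T ≤ T₂
  time_le : T₂ ≤ T + 2 * R / a
  end_eq : p T₂ = (0, U 0)
  fst_near : |(p T).1 - xT| ≤ σ
  snd_near : |(p T).2 - yT| ≤ σ
  norm_le : ∀ t ∈ Icc 0 T₂, ‖p t‖ ≤ R

lemma IsTrajectory.exists_returnArc (hg : DampingBounds g a b e κ η N Λ Q)
    (hC : ArcConstants a b c δ e κ η R N Λ Q) (hL : LowerArc a b c δ e σ ρ R T x y)
    (hp : IsTrajectory g a p) (hp0 : ‖p 0‖ ≤ ρ) :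
    ∃ U T₂, ReturnArc g a c δ κ η R σ T (x T) (y T) p T₂ U := by
  have ha := hC.a_pos
  have hRp := hC.R_pos
  have hηa := hC.η_le_a
  have haR := hL.a_le
  have hσ := hL.σ_pos
  have hTp := hL.T_pos
  have hnear : ∀ t ∈ Icc 0 T, sqDist (p t) (x t, y t) ≤ σ ^ 2 := by
    intro t ht
    have h := hp.sqDist_linear_le hg.one_sided hg.linear_le hg.le_linear hL.hasDerivAt_x
      hL.hasDerivAt_y hL.nonpos ht
    have h0 : sqDist (p 0) (x 0, y 0) ≤ 2 * ρ ^ 2 := by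
      refine (sqDist_le_two_mul_dist_sq _ _).trans ?_
      have : dist (p 0) (x 0, y 0) = ‖p 0‖ := by
        rw [hL.x_zero, hL.y_zero]; exact dist_zero_right _
      rw [this]; gcongr
    have h1 : (sqDist (p 0) (x 0, y 0) + e ^ 2) * Real.exp (7 * t) ≤
        (2 * ρ ^ 2 + e ^ 2) * Real.exp (7 * T) := by
      gcongr
      exact ht.2
    nlinarith [hL.growth, sq_nonneg e]
  have hxT := abs_fst_sub_le_of_sqDist_le hσ.le (hnear T ⟨hTp.le, le_rfl⟩)
  have hyT := abs_snd_sub_le_of_sqDist_le hσ.le (hnear T ⟨hTp.le, le_rfl⟩)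
  have hxb := hL.x_bound T ⟨hTp.le, le_rfl⟩
  have hV : 0 ≤ 2 * (R + 1) / a * (2 * σ) := by positivity
  have := hL.x_end
  have := hL.y_end_le
  have := hL.le_y_end
  obtain ⟨hx1, hx2⟩ := abs_le.1 hxT
  obtain ⟨hy1, hy2⟩ := abs_le.1 hyT
  obtain ⟨U, T₂, hU, hU0, hT₂, hT₂', hend, hall⟩ := hp.exists_upperArc hg hC (t₁ := T)
    (by simp at *; linarith) (by simp at *; linarith [neg_abs_le (x T)]) (by simp at *; linarith)
    (by simp at *; linarith)
  refine ⟨U, T₂, hU, hU0, hT₂, hT₂', hend, hxT, hyT, fun t ht => ?_⟩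
  rcases le_total t T with h | h
  · have h1 := abs_fst_sub_le_of_sqDist_le hσ.le (hnear t ⟨ht.1, h⟩)
    have h2 := abs_snd_sub_le_of_sqDist_le hσ.le (hnear t ⟨ht.1, h⟩)
    have h3 := hL.x_bound t ⟨ht.1, h⟩
    have h4 := hL.y_bound t ⟨ht.1, h⟩
    rw [Prod.norm_def]
    refine max_le ?_ ?_
    · have := abs_add_le ((p t).1 - x t) (x t)
      rw [sub_add_cancel] at this
      rw [Real.norm_eq_abs]; linarith
    · have := abs_add_le ((p t).2 - y t) (y t)
      rw [sub_add_cancel] at this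
      rw [Real.norm_eq_abs]; linarith
  · obtain ⟨ξ, hξ, hpt⟩ := hall t ⟨h, ht.2⟩
    rw [hpt, Prod.norm_def]
    refine max_le ?_ ?_ <;> rw [Real.norm_eq_abs, abs_le]
    · have : -R ≤ (p T).1 := by simp at *; linarith [neg_abs_le (x T)]
      exact ⟨this.trans hξ.1, hξ.2.trans hRp.le⟩
    · have h1 := hU.ge_half ξ hξ
      have h2 := hU.le_top ξ hξ
      constructor <;> simp only <;> linarith

lemma ReturnArc.end_mem {T₂ : ℝ} {U : ℝ → ℝ} (h : ReturnArc g a c δ κ η R σ T (x T) (y T) p T₂ U)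
    (hC : ArcConstants a b c δ e κ η R N Λ Q) (hL : LowerArc a b c δ e σ ρ R T x y) :
    U 0 ∈ Icc (-η) η := by
  refine ⟨h.upper.ge_end, h.upper.le_top 0 ⟨?_, le_rfl⟩⟩
  have := hL.x_end
  have := hC.c_pos
  linarith [(abs_le.1 h.fst_near).2]

/-- The difference of two upper arcs at the right-most starting point, for arcs whose starting
points are close to each other. -/
lemma ReturnArc.abs_sub_le_of_fst_le {p q : ℝ → ℝ × ℝ} {T₂ T₃ : ℝ} {U W : ℝ → ℝ}
    (hg : DampingBounds g a b e κ η N Λ Q)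
    (hC : ArcConstants a b c δ e κ η R N Λ Q) (hL : LowerArc a b c δ e σ ρ R T x y)
    (hp : ReturnArc g a c δ κ η R σ T (x T) (y T) p T₂ U)
    (hq : ReturnArc g a c δ κ η R σ T (x T) (y T) q T₃ W)
    (hpq : (p T).1 ≤ (q T).1) {D : ℝ} (hD0 : 0 ≤ D) (hD : sqDist (p T) (q T) ≤ D ^ 2) :
    (U 0 - W 0) ^ 2 ≤
      ((1 + 2 * (R + 1) / a) * D) ^ 2 * Real.exp (2 * Λ * R - Q * c) := by
  have ha := hC.a_pos
  have hc := hC.c_pos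
  have hRp := hC.R_pos
  have hσ := hL.σ_pos
  have h1 := abs_fst_sub_le_of_sqDist_le hD0 hD
  have h2 := abs_snd_sub_le_of_sqDist_le hD0 hD
  have hV : 0 ≤ 2 * (R + 1) / a := by positivity
  have hpx := abs_le.1 hp.fst_near
  have hqx := abs_le.1 hq.fst_near
  have hpy := abs_le.1 hp.snd_near
  have hend := hL.x_end
  have hxb := hL.x_bound T ⟨hL.T_pos.le, le_rfl⟩
  have hRle : -R ≤ (p T).1 := by linarith [neg_abs_le (x T)]
  have hmem : (q T).1 ∈ Icc (p T).1 (-c) := ⟨hpq, by linarith⟩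
  have hup : ∀ t ∈ Icc (p T).1 (q T).1, U t ≤ 0 := by
    intro t ht
    have h3 := hp.upper.sub_le hg hC hRle (x := t) ⟨ht.1, by linarith [ht.2, hmem.2]⟩
    rw [hp.start] at h3
    have h4 : 2 * (R + 1) / a * (t - (p T).1) ≤ 2 * (R + 1) / a * (2 * σ) := by
      gcongr; linarith [ht.2]
    linarith [hL.y_end_le]
  have h5 := hp.upper.nonneg_sub hg hC hmem hup
  have h6 := hp.upper.sub_le hg hC hRle (x := (q T).1) ⟨hpq, by linarith [hmem.2]⟩
  have h7 : 2 * (R + 1) / a * ((q T).1 - (p T).1) ≤ 2 * (R + 1) / a * D := by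
    gcongr; linarith [(abs_le.1 h1).1]
  have h8 := hp.upper.sq_sub_le hg hC hq.upper hpq le_rfl (hRle.trans hpq) hmem.2
  refine h8.trans ?_
  gcongr ?_ * _
  rw [hp.start] at h5 h6
  rw [hq.start]
  rw [abs_le] at h2
  apply sq_le_sq'
  · nlinarith
  · nlinarith

lemma ReturnArc.sq_sub_le {p q : ℝ → ℝ × ℝ} {T₂ T₃ : ℝ} {U W : ℝ → ℝ}
    (hg : DampingBounds g a b e κ η N Λ Q)
    (hC : ArcConstants a b c δ e κ η R N Λ Q) (hL : LowerArc a b c δ e σ ρ R T x y)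
    (hpt : IsTrajectory g a p) (hqt : IsTrajectory g a q)
    (hp : ReturnArc g a c δ κ η R σ T (x T) (y T) p T₂ U)
    (hq : ReturnArc g a c δ κ η R σ T (x T) (y T) q T₃ W) :
    (U 0 - W 0) ^ 2 ≤ (1 + 2 * (R + 1) / a) ^ 2 * Real.exp (6 * T) *
      Real.exp (2 * Λ * R - Q * c) * sqDist (p 0) (q 0) := by
  have h1 := hpt.sqDist_le hg.one_sided hqt hL.T_pos.le
  set D := √(sqDist (p 0) (q 0) * Real.exp (6 * T)) with hD
  have hD0 : 0 ≤ D := Real.sqrt_nonneg _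
  have hD2 : D ^ 2 = sqDist (p 0) (q 0) * Real.exp (6 * T) :=
    Real.sq_sqrt (mul_nonneg (sqDist_nonneg _ _) (Real.exp_nonneg _))
  rw [← hD2] at h1
  have h2 : ((1 + 2 * (R + 1) / a) * D) ^ 2 * Real.exp (2 * Λ * R - Q * c) =
      (1 + 2 * (R + 1) / a) ^ 2 * Real.exp (6 * T) *
      Real.exp (2 * Λ * R - Q * c) * sqDist (p 0) (q 0) := by
    rw [mul_pow, hD2]; ring
  rw [← h2]
  rcases le_total (p T).1 (q T).1 with h | h
  · exact hp.abs_sub_le_of_fst_le hg hC hL hq h hD0 h1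
  · have h1' : sqDist (q T) (p T) ≤ D ^ 2 := by
      refine le_of_eq_of_le ?_ h1
      unfold sqDist; ring
    have := hq.abs_sub_le_of_fst_le hg hC hL hp h hD0 h1'
    rwa [← neg_sub, neg_sq]

end ReturnMap

section ContractingReturn

open Set Filter Topology

/-- The flow `φ` (with the time as second argument) brings the section `S '' Icc (-η) η` back to
itself through a contraction `P`, in times `τ` between `m` and `M`. -/
structure ContractingReturn {X : Type*} [MetricSpace X] (φ : X → ℝ → X) (S : ℝ → X)
    (η m M : ℝ) (P τ : ℝ → ℝ) : Prop where
  flow_zero : ∀ z, φ z 0 = z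
  flow_add : ∀ z t s, φ z (t + s) = φ (φ z s) t
  η_pos : 0 < η
  m_pos : 0 < m
  dist_section : ∀ s s', dist (S s) (S s') ≤ |s - s'|
  mapsTo : ∀ s ∈ Icc (-η) η, P s ∈ Icc (-η) η
  m_le : ∀ s ∈ Icc (-η) η, m ≤ τ s
  le_M : ∀ s ∈ Icc (-η) η, τ s ≤ M
  flow_return : ∀ s ∈ Icc (-η) η, φ (S s) (τ s) = S (P s)
  contracting : ∀ s ∈ Icc (-η) η, ∀ s' ∈ Icc (-η) η, |P s - P s'| ≤ 1 / 2 * |s - s'|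

namespace ContractingReturn

variable {X : Type*} [MetricSpace X] {φ : X → ℝ → X} {S : ℝ → X} {η m M : ℝ} {P τ : ℝ → ℝ}

lemma flow_sub (h : ContractingReturn φ S η m M P τ) {s : ℝ} (hs : s ∈ Icc (-η) η) (t : ℝ) :
    φ (S s) t = φ (S (P s)) (t - τ s) := by
  rw [← h.flow_return s hs, ← h.flow_add, sub_add_cancel]

lemma exists_fixed (h : ContractingReturn φ S η m M P τ) :
    ∃ s ∈ Icc (-η) η, P s = s := by
  have hc : IsComplete (Icc (-η) η) := isClosed_Icc.isComplete
  have hK : ContractingWith (1 / 2) (MapsTo.restrict P (Icc (-η) η) (Icc (-η) η) h.mapsTo) := by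
    refine ⟨by rw [← NNReal.coe_lt_coe]; norm_num, LipschitzWith.of_dist_le_mul fun s s' => ?_⟩
    have := h.contracting s s.2 s' s'.2
    rw [Subtype.dist_eq, Subtype.dist_eq, Real.dist_eq, Real.dist_eq]
    have h2 : ((1 / 2 : NNReal) : ℝ) = 1 / 2 := by norm_num
    rw [h2]
    exact this
  have h0 : (0 : ℝ) ∈ Icc (-η) η := ⟨by linarith [h.η_pos], h.η_pos.le⟩
  obtain ⟨s, hs, hfix, -⟩ := hK.exists_fixedPoint' hc h.mapsTo h0 (edist_ne_top _ _)
  exact ⟨s, hs, hfix⟩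

lemma forall_mem (h : ContractingReturn φ S η m M P τ) {B : Set X}
    (hB : ∀ s ∈ Icc (-η) η, ∀ t ∈ Icc 0 (τ s), φ (S s) t ∈ B) {s : ℝ} (hs : s ∈ Icc (-η) η)
    {t : ℝ} (ht : 0 ≤ t) : φ (S s) t ∈ B := by
  have key : ∀ N : ℕ, ∀ s ∈ Icc (-η) η, ∀ t, 0 ≤ t → t ≤ N * m → φ (S s) t ∈ B := by
    intro N
    induction N with
    | zero =>
      intro s hs t ht ht'
      exact hB s hs t ⟨ht, by linarith [h.m_le s hs, h.m_pos, (by simpa using ht' : t ≤ 0)]⟩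
    | succ N ih =>
      intro s hs t ht ht'
      rcases le_total t (τ s) with hle | hle
      · exact hB s hs t ⟨ht, hle⟩
      · rw [h.flow_sub hs]
        refine ih _ (h.mapsTo s hs) _ (by linarith) ?_
        push_cast at ht'
        linarith [h.m_le s hs]
  obtain ⟨N, hN⟩ := exists_nat_ge (t / m)
  exact key N s hs t ht ((div_le_iff₀ h.m_pos).1 hN)

/-- Trajectories starting on the section approach the periodic orbit of the fixed point. -/
lemma tendsto_infDist (h : ContractingReturn φ S η m M P τ) {C : ℝ} (hC : 0 ≤ C)
    (hgrow : ∀ z w, ∀ t ∈ Icc 0 M, dist (φ z t) (φ w t) ≤ C * dist z w) {s₀ : ℝ}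
    (hs₀ : s₀ ∈ Icc (-η) η) (hfix : P s₀ = s₀) {s : ℝ} (hs : s ∈ Icc (-η) η) :
    Tendsto (fun t => Metric.infDist (φ (S s) t) (range (φ (S s₀)))) atTop (𝓝 0) := by
  set d : ℝ → X → ℝ := fun t z => Metric.infDist (φ z t) (range (φ (S s₀))) with hd
  have hstep : ∀ s ∈ Icc (-η) η, |P s - s₀| ≤ 1 / 2 * |s - s₀| := fun s hs => by
    have := h.contracting s hs s₀ hs₀
    rwa [hfix] at this
  have key : ∀ N : ℕ, ∀ s ∈ Icc (-η) η, ∀ t, 0 ≤ t → t ≤ N * m →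
      d t (S s) ≤ C * |s - s₀| := by
    have hfirst : ∀ s ∈ Icc (-η) η, ∀ t, 0 ≤ t → t ≤ τ s → d t (S s) ≤ C * |s - s₀| := by
      intro s hs t ht ht'
      refine (Metric.infDist_le_dist_of_mem (mem_range_self t)).trans ?_
      refine (hgrow _ _ t ⟨ht, ht'.trans (h.le_M s hs)⟩).trans ?_
      gcongr
      exact h.dist_section _ _
    intro N
    induction N with
    | zero =>
      intro s hs t ht ht'
      exact hfirst s hs t ht (by linarith [h.m_le s hs, h.m_pos, (by simpa using ht' : t ≤ 0)])
    | succ N ih =>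
      intro s hs t ht ht'
      rcases le_total t (τ s) with hle | hle
      · exact hfirst s hs t ht hle
      · simp only [hd]
        rw [h.flow_sub hs]
        refine (ih _ (h.mapsTo s hs) _ (by linarith) ?_).trans ?_
        · push_cast at ht'
          linarith [h.m_le s hs]
        · exact mul_le_mul_of_nonneg_left (by linarith [hstep s hs, abs_nonneg (s - s₀)]) hC
  have decay : ∀ n : ℕ, ∀ s ∈ Icc (-η) η, ∀ t, n * M ≤ t → d t (S s) ≤ C * |s - s₀| / 2 ^ n := by
    have hM : 0 ≤ M := h.m_pos.le.trans ((h.m_le s hs).trans (h.le_M s hs))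
    intro n
    induction n with
    | zero =>
      intro s hs t ht
      have ht0 : 0 ≤ t := by simpa using ht
      obtain ⟨N, hN⟩ := exists_nat_ge (t / m)
      simpa using key N s hs t ht0 ((div_le_iff₀ h.m_pos).1 hN)
    | succ n ih =>
      intro s hs t ht
      push_cast at ht
      simp only [hd]
      rw [h.flow_sub hs]
      refine (ih _ (h.mapsTo s hs) _ (by linarith [h.le_M s hs])).trans ?_
      rw [pow_succ, mul_comm ((2 : ℝ) ^ n), ← div_div]
      gcongr
      have := mul_le_mul_of_nonneg_left (hstep s hs) hC
      linarith
  have hlim : Tendsto (fun n : ℕ => C * |s - s₀| / 2 ^ n) atTop (𝓝 0) := by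
    have := (tendsto_pow_atTop_nhds_zero_of_lt_one (r := (1 / 2 : ℝ)) (by norm_num)
      (by norm_num)).const_mul (C * |s - s₀|)
    simpa [div_eq_mul_inv] using this
  rw [Metric.tendsto_atTop]
  intro ε hε
  obtain ⟨n, hn⟩ := (hlim.eventually (gt_mem_nhds hε)).exists
  refine ⟨n * M, fun t ht => ?_⟩
  rw [Real.dist_0_eq_abs, abs_of_nonneg Metric.infDist_nonneg]
  exact (decay n s hs t ht).trans_lt hn

/-- An orbit with closed image that meets the section contains the fixed point. -/
lemma fixed_mem_range (h : ContractingReturn φ S η m M P τ) {s₀ : ℝ}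
    (hs₀ : s₀ ∈ Icc (-η) η) (hfix : P s₀ = s₀) {s : ℝ} (hs : s ∈ Icc (-η) η)
    (hcl : IsClosed (range (φ (S s)))) : S s₀ ∈ range (φ (S s)) := by
  have hn : ∀ n : ℕ, ∃ s' ∈ Icc (-η) η, S s' ∈ range (φ (S s)) ∧
      |s' - s₀| ≤ (1 / 2) ^ n * |s - s₀| := by
    intro n
    induction n with
    | zero => exact ⟨s, hs, ⟨0, h.flow_zero _⟩, by simp⟩
    | succ n ih =>
      obtain ⟨s', hs', ⟨t, ht⟩, hle⟩ := ih
      refine ⟨P s', h.mapsTo s' hs', ⟨τ s' + t, ?_⟩, ?_⟩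
      · rw [h.flow_add, ht, h.flow_return s' hs']
      · have := h.contracting s' hs' s₀ hs₀
        rw [hfix] at this
        rw [pow_succ]
        linarith
  choose σ hσ hmem hle using hn
  refine hcl.mem_of_tendsto (f := fun n => S (σ n)) (b := atTop) ?_
    (Eventually.of_forall hmem)
  rw [tendsto_iff_dist_tendsto_zero]
  have hlim : Tendsto (fun n : ℕ => (1 / 2 : ℝ) ^ n * |s - s₀|) atTop (𝓝 0) := by
    simpa using (tendsto_pow_atTop_nhds_zero_of_lt_one (r := (1 / 2 : ℝ)) (by norm_num)
      (by norm_num)).mul_const |s - s₀|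
  exact squeeze_zero (fun _ => dist_nonneg) (fun n => (h.dist_section _ _).trans (hle n)) hlim

end ContractingReturn

end ContractingReturn

section PeriodicTrajectories

open Set Filter Topology

lemma exists_first_zero {f f' : ℝ → ℝ} (hf : ∀ t, HasDerivAt f (f' t) t) {t₀ t₁ : ℝ}
    (h01 : t₀ ≤ t₁) (h0 : 0 < f t₀) (h1 : f t₁ ≤ 0) :
    ∃ s ∈ Icc t₀ t₁, f s = 0 ∧ (∀ t ∈ Icc t₀ s, 0 ≤ f t) ∧ f' s ≤ 0 := by
  have hcont : Continuous f := continuous_iff_continuousAt.2 fun t => (hf t).continuousAt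
  set A : Set ℝ := Icc t₀ t₁ ∩ f ⁻¹' Iic 0 with hA
  have hAc : IsCompact A := isCompact_Icc.inter_right (isClosed_Iic.preimage hcont)
  have hne : A.Nonempty := ⟨t₁, ⟨h01, le_rfl⟩, h1⟩
  obtain ⟨hsI, hs⟩ : sInf A ∈ A := hAc.sInf_mem hne
  have hmin : ∀ t ∈ A, sInf A ≤ t := fun t ht => csInf_le hAc.bddBelow ht
  set s := sInf A
  have hpos : ∀ t ∈ Ico t₀ s, 0 < f t := by
    intro t ht
    by_contra hcon
    exact absurd (hmin t ⟨⟨ht.1, ht.2.le.trans hsI.2⟩, not_lt.1 hcon⟩) (not_le.2 ht.2)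
  have hs0 : f s = 0 := by
    obtain ⟨u, hu, hfu⟩ := intermediate_value_Icc' hsI.1 hcont.continuousOn
      (⟨hs, h0.le⟩ : (0 : ℝ) ∈ Icc (f s) (f t₀))
    have : s = u := le_antisymm (hmin u ⟨⟨hu.1, hu.2.trans hsI.2⟩, hfu.le⟩) hu.2
    rw [this, hfu]
  refine ⟨s, hsI, hs0, fun t ht => ?_, ?_⟩
  · rcases ht.2.lt_or_eq with h | h
    · exact (hpos t ⟨ht.1, h⟩).le
    · rw [h, hs0]
  · have hlt : t₀ < s := by
      rcases hsI.1.lt_or_eq with h | h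
      · exact h
      · rw [← h] at hs0; exact absurd hs0 h0.ne'
    have hlim := (hasDerivWithinAt_iff_tendsto_slope' (notMem_Iio.2 le_rfl)).1
      ((hf s).hasDerivWithinAt (s := Iio s))
    refine le_of_tendsto hlim ?_
    filter_upwards [Ioo_mem_nhdsLT hlt] with t ht
    rw [slope_def_field, hs0]
    exact div_nonpos_of_nonneg_of_nonpos (by simpa using (hpos t ⟨ht.1.le, ht.2⟩).le)
      (by linarith [ht.2])

lemma exists_last_zero {f f' : ℝ → ℝ} (hf : ∀ t, HasDerivAt f (f' t) t) {t₀ t₁ : ℝ}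
    (h01 : t₀ ≤ t₁) (h0 : f t₀ ≤ 0) (h1 : 0 < f t₁) :
    ∃ s ∈ Icc t₀ t₁, f s = 0 ∧ (∀ t ∈ Icc s t₁, 0 ≤ f t) ∧ 0 ≤ f' s := by
  obtain ⟨s, hs, hs0, hpos, hder⟩ := exists_first_zero (f := fun t => f (-t))
    (f' := fun t => -f' (-t)) (t₀ := -t₁) (t₁ := -t₀)
    (fun t => ((hf (-t)).comp t (hasDerivAt_neg t)).congr_deriv (by simp)) (by linarith) (by simpa)
    (by simpa)
  refine ⟨-s, ⟨by linarith [hs.2], by linarith [hs.1]⟩, hs0, fun t ht => ?_, by linarith⟩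
  simpa using hpos (-t) ⟨by linarith [ht.2], by linarith [ht.1]⟩

lemma exists_nat_le_add_mul {T : ℝ} (hT : 0 < T) (s t : ℝ) : ∃ n : ℕ, t ≤ s + n * T := by
  obtain ⟨n, hn⟩ := exists_nat_ge ((t - s) / T)
  exact ⟨n, by linarith [(div_le_iff₀ hT).1 hn]⟩

variable {g : ℝ → ℝ} {a b c δ e κ η R N Λ Q σ ρ T r : ℝ} {q : ℝ → ℝ × ℝ}

/-- A periodic trajectory in the lower half plane is constant. -/
lemma IsTrajectory.exists_pos_of_periodic (hg : DampingBounds g a b e κ η N Λ Q) (hb : 0 < b)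
    (hq : IsTrajectory g a q) (hT : 0 < T) (hper : Function.Periodic q T)
    (hne : ∃ t₁ t₂, q t₁ ≠ q t₂) : ∃ t, 0 < (q t).2 := by
  by_contra! hle
  set V : ℝ → ℝ := fun t => ((q t).1 - g (-a)) ^ 2 + ((q t).2 + a) ^ 2 with hV
  have hVd : ∀ t, HasDerivAt V (2 * (((q t).2 + a) * (g (q t).2 - g (-a)))) t := fun t => by
    refine ((((hq.fst t).sub_const _).pow 2).add (((hq.snd t).add_const _).pow 2)).congr_deriv ?_
    push_cast
    ring
  have hVnn : ∀ t, 0 ≤ 2 * (((q t).2 + a) * (g (q t).2 - g (-a))) := fun t => by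
    have := hg.mono _ (hle t)
    have h2 : 0 ≤ b * ((q t).2 + a) ^ 2 := by positivity
    linarith
  have hmono : Monotone V := monotone_of_deriv_nonneg (fun t => (hVd t).differentiableAt)
    fun t => by rw [(hVd t).deriv]; exact hVnn t
  have hVper : Function.Periodic V T := fun t => by simp only [hV, hper t]
  have hconst : ∀ s t, V t ≤ V s := fun s t => by
    obtain ⟨n, hn⟩ := exists_nat_le_add_mul hT s t
    exact (hmono hn).trans_eq (hVper.nat_mul n s)
  have hzero : ∀ t, (q t).2 + a = 0 := fun t => by
    have h1 : HasDerivAt V 0 t := by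
      have : V = fun _ => V 0 := funext fun s => le_antisymm (hconst _ _) (hconst _ _)
      rw [this]; exact hasDerivAt_const t _
    have h2 := (hVd t).unique h1
    have h3 := hg.mono _ (hle t)
    have h4 : ((q t).2 + a) ^ 2 ≤ 0 := by
      by_contra hcon
      have := mul_pos hb (not_le.1 hcon)
      linarith
    exact pow_eq_zero_iff (two_ne_zero) |>.1 (le_antisymm h4 (sq_nonneg _))
  have hsnd : ∀ t, (q t).2 = -a := fun t => by linarith [hzero t]
  have hfst : ∀ t, (q t).1 = g (-a) := fun t => by
    have h1 : HasDerivAt (fun t => (q t).2) 0 t := by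
      have : (fun t => (q t).2) = fun _ => -a := funext hsnd
      rw [this]; exact hasDerivAt_const t _
    have h2 := (hq.snd t).unique h1
    rw [hsnd] at h2
    linarith
  obtain ⟨t₁, t₂, h⟩ := hne
  exact h (Prod.ext (by rw [hfst, hfst]) (by rw [hsnd, hsnd]))

lemma IsTrajectory.snd_le_of_periodic (hg : DampingBounds g a b e κ η N Λ Q) (hr : r < N)
    (hq : IsTrajectory g a q) (hT : 0 < T) (hper : Function.Periodic q T)
    (hball : ∀ t, ‖q t‖ ≤ r) (t : ℝ) : (q t).2 ≤ η := by
  have hx : ∀ t, -(q t).1 ≤ r := fun t =>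
    (neg_le_abs _).trans ((norm_fst_le (q t)).trans (hball t))
  have hper2 : ∀ (n : ℕ) (t : ℝ), (q (t + n * T)).2 = (q t).2 := fun n t => by
    rw [hper.nat_mul n t]
  obtain ⟨s, hs⟩ : ∃ s, (q s).2 ≤ η := by
    by_contra! hcon
    have := sub_le_mul_of_deriv_le (k := r - N) hT.le (fun t _ => hq.snd t)
      fun t _ => by linarith [hg.strong _ (hcon t).le, hx t]
    have h1 := hper 0
    rw [zero_add] at h1
    rw [h1] at this
    nlinarith
  obtain ⟨n, hn⟩ := exists_nat_le_add_mul hT t s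
  have := le_line_of_deriv_lt (k := 0) (t₀ := s) (t₁ := t + n * T) (fun t _ => hq.snd t) hs
    (fun u _ hu => ?_) _ ⟨hn, le_rfl⟩
  · rw [hper2] at this; linarith
  · have := hg.strong (q u).2 (by linarith)
    linarith [hx u]

/-- A nonconstant periodic trajectory in the ball meets the section. -/
lemma IsTrajectory.exists_mem_section (hg : DampingBounds g a b e κ η N Λ Q) (hg0 : g 0 = 0)
    (ha : 0 < a) (hb : 0 < b) (hη : 0 < η) (hr : r < N)
    (hq : IsTrajectory g a q) (hT : 0 < T) (hper : Function.Periodic q T)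
    (hne : ∃ t₁ t₂, q t₁ ≠ q t₂) (hball : ∀ t, ‖q t‖ ≤ r) :
    ∃ t, ∃ s ∈ Icc (-η) η, q t = (0, s) := by
  obtain ⟨t₁, ht₁⟩ := hq.exists_pos_of_periodic hg hb hT hper hne
  obtain ⟨u, hu⟩ : ∃ u, (q u).2 ≤ 0 := by
    by_contra! hcon
    have := mul_le_sub_of_le_deriv (k := a) hT.le (fun t _ => hq.fst t)
      fun t _ => by linarith [hcon t]
    have h1 := hper 0
    rw [zero_add] at h1
    rw [h1] at this
    nlinarith
  obtain ⟨n, hn⟩ := exists_nat_le_add_mul hT u t₁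
  obtain ⟨m, hm⟩ := exists_nat_le_add_mul hT t₁ u
  have hu1 : (q (u + n * T)).2 ≤ 0 := by rw [hper.nat_mul n u]; exact hu
  have hu2 : (q (u - m * T)).2 ≤ 0 := by rw [hper.sub_nat_mul_eq m]; exact hu
  obtain ⟨s', hs', hs'0, hpos', hd'⟩ := exists_first_zero hq.snd hn ht₁ hu1
  obtain ⟨s, hs, hs0, hpos, hd⟩ := exists_last_zero hq.snd (by linarith : u - m * T ≤ t₁) hu2 ht₁
  rw [hs'0, hg0] at hd'
  rw [hs0, hg0] at hd
  have hcont : Continuous fun t => (q t).1 := continuous_fst.comp hq.continuous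
  obtain ⟨t, ht, ht0⟩ := intermediate_value_Icc (hs.2.trans hs'.1) hcont.continuousOn
    (⟨by linarith, by linarith⟩ : (0 : ℝ) ∈ Icc ((q s).1) ((q s').1))
  refine ⟨t, (q t).2, ⟨?_, hq.snd_le_of_periodic hg hr hT hper hball t⟩, Prod.ext ht0 rfl⟩
  have : 0 ≤ (q t).2 := by
    rcases le_total t t₁ with h | h
    · exact hpos t ⟨ht.1, h⟩
    · exact hpos' t ⟨h, ht.2⟩
  linarith

end PeriodicTrajectories

section LimitCycle

open Set Filter Topology

variable {g : ℝ → ℝ} {a b c δ e κ η R N Λ Q σ ρ T r : ℝ} {x y : ℝ → ℝ}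

lemma exists_planarFlow (hg : ∃ K, LipschitzWith K g) (a : ℝ) :
    ∃ φ : ℝ × ℝ → ℝ → ℝ × ℝ, (∀ z, φ z 0 = z) ∧ (∀ z, IsTrajectory g a (φ z)) ∧
      (∀ z t s, φ z (t + s) = φ (φ z s) t) ∧
      ∀ q s, IsTrajectory g a q → ∀ t, q (t + s) = φ (q s) t := by
  obtain ⟨K, hK⟩ := hg
  obtain ⟨K', hK'⟩ := lipschitzWith_planarField hK a
  choose φ hφ0 hφ using exists_integral_curve_of_lipschitz hK'
  have huniq : ∀ q s, IsTrajectory g a q → ∀ t, q (t + s) = φ (q s) t := fun q s hq t =>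
    congrFun ((hq.shift s).eq_of_eq hK (hφ (q s)) (s := 0) (by simp [hφ0])) t
  exact ⟨φ, hφ0, hφ, fun z t s => huniq _ _ (hφ z) t, huniq⟩

lemma exists_contractingReturn (hg : DampingBounds g a b e κ η N Λ Q)
    (hC : ArcConstants a b c δ e κ η R N Λ Q) (hL : LowerArc a b c δ e σ ρ R T x y)
    (hη : η < ρ) (hcontr : (1 + 2 * (R + 1) / a) ^ 2 * Real.exp (6 * T) *
      Real.exp (2 * Λ * R - Q * c) ≤ 1 / 4) {φ : ℝ × ℝ → ℝ → ℝ × ℝ} (hφ0 : ∀ z, φ z 0 = z)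
    (hφ : ∀ z, IsTrajectory g a (φ z)) (hadd : ∀ z t s, φ z (t + s) = φ (φ z s) t) :
    ∃ P τ, ContractingReturn φ (fun s => ((0 : ℝ), s)) η T (T + 2 * R / a) P τ ∧
      ∀ s ∈ Icc (-η) η, ∀ t ∈ Icc 0 (τ s), ‖φ (0, s) t‖ ≤ R := by
  have hnorm : ∀ s ∈ Icc (-η) η, ‖φ (0, s) 0‖ ≤ ρ := fun s hs => by
    rw [hφ0, Prod.norm_def]
    simp only [norm_zero, Real.norm_eq_abs]
    exact max_le hL.ρ_pos.le ((abs_le.2 hs).trans hη.le)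
  have hret : ∀ s, ∃ U T₂, s ∈ Icc (-η) η →
      ReturnArc g a c δ κ η R σ T (x T) (y T) (φ (0, s)) T₂ U := fun s => by
    by_cases hs : s ∈ Icc (-η) η
    · obtain ⟨U, T₂, h⟩ := (hφ (0, s)).exists_returnArc hg hC hL (hnorm s hs)
      exact ⟨U, T₂, fun _ => h⟩
    · exact ⟨0, 0, fun h => absurd h hs⟩
  choose U τ hU using hret
  refine ⟨fun s => U s 0, τ, ⟨hφ0, hadd, hC.η_pos, hL.T_pos, fun s s' => ?_, fun s hs => ?_,
    fun s hs => (hU s hs).le_time, fun s hs => (hU s hs).time_le, fun s hs => (hU s hs).end_eq,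
    fun s hs s' hs' => ?_⟩, fun s hs => (hU s hs).norm_le⟩
  · rw [Prod.dist_eq, dist_self, Real.dist_eq]
    exact max_le (abs_nonneg _) le_rfl
  · exact (hU s hs).end_mem hC hL
  · have h1 := (hU s hs).sq_sub_le hg hC hL (hφ _) (hφ _) (hU s' hs')
    have h2 : sqDist (φ (0, s) 0) (φ (0, s') 0) = (s - s') ^ 2 := by
      simp [hφ0, sqDist]
    rw [h2] at h1
    refine abs_le_of_sq_le_sq ?_ (by positivity)
    rw [mul_pow, sq_abs]
    refine h1.trans ((mul_le_mul_of_nonneg_right hcontr (sq_nonneg _)).trans_eq ?_)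
    norm_num

/-- Existence, uniqueness and attractivity of a limit cycle of `ẋ = y + a, ẏ = -x + g y`. -/
theorem exists_limitCycle (hg : DampingBounds g a b e κ η N Λ Q) (hg0 : g 0 = 0)
    (hC : ArcConstants a b c δ e κ η R N Λ Q) (hL : LowerArc a b c δ e σ ρ R T x y)
    (hη : η < ρ) (hcontr : (1 + 2 * (R + 1) / a) ^ 2 * Real.exp (6 * T) *
      Real.exp (2 * Λ * R - Q * c) ≤ 1 / 4) (hr : r < N) :
    ∃ p, IsTrajectory g a p ∧ (∃ T > 0, Function.Periodic p T) ∧ (∃ t₁ t₂, p t₁ ≠ p t₂) ∧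
      (∀ t, ‖p t‖ ≤ R) ∧
      (∀ q, IsTrajectory g a q → (∃ T > 0, Function.Periodic q T) → (∃ t₁ t₂, q t₁ ≠ q t₂) →
        (∀ t, ‖q t‖ ≤ r) → range q = range p) ∧
      ∃ V, IsOpen V ∧ range p ⊆ V ∧ ∀ z ∈ V, ∃ q, q 0 = z ∧ IsTrajectory g a q ∧
        (∀ t ≥ 0, ‖q t‖ ≤ R + 1) ∧
        Tendsto (fun t => Metric.infDist (q t) (range p)) atTop (𝓝 0) := by
  have ha := hC.a_pos
  have hRp := hC.R_pos
  obtain ⟨φ, hφ0, hφ, hadd, huniq⟩ := exists_planarFlow hg.lipschitz a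
  obtain ⟨P, τ, hP, hPR⟩ := exists_contractingReturn hg hC hL hη hcontr hφ0 hφ hadd
  obtain ⟨s₀, hs₀, hfix⟩ := hP.exists_fixed
  set M := T + 2 * R / a with hM
  have hτpos : 0 < τ s₀ := hL.T_pos.trans_le (hP.m_le _ hs₀)
  have hτ : φ (0, s₀) (τ s₀) = (0, s₀) := by
    have := hP.flow_return s₀ hs₀
    rwa [hfix] at this
  have hper : Function.Periodic (φ (0, s₀)) (τ s₀) := fun t => by rw [hadd, hτ]
  have hbound : ∀ s ∈ Icc (-η) η, ∀ t, 0 ≤ t → ‖φ (0, s) t‖ ≤ R := fun s hs t ht =>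
    hP.forall_mem (B := {z | ‖z‖ ≤ R}) hPR hs ht
  have hrep : ∀ t, ∃ u ∈ Icc 0 (τ s₀), φ (0, s₀) t = φ (0, s₀) u := fun t => by
    obtain ⟨u, hu, he⟩ := hper.exists_mem_Ico₀ hτpos t
    exact ⟨u, Ico_subset_Icc_self hu, he⟩
  have hgrow : ∀ z w, ∀ t ∈ Icc 0 M, dist (φ z t) (φ w t) ≤
      2 * Real.exp (3 * M) * dist z w := fun z w t ht => by
    have := (hφ z).dist_le hg.one_sided (hφ w) ht.1
    rw [hφ0, hφ0] at this
    refine this.trans ?_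
    gcongr
    exact ht.2
  refine ⟨φ (0, s₀), hφ _, ⟨τ s₀, hτpos, hper⟩, ?_, ?_, ?_, ?_⟩
  · by_contra! hcon
    have hconst : (fun t => (φ (0, s₀) t).1) = fun _ => (φ (0, s₀) 0).1 :=
      funext fun t => by rw [hcon t 0]
    have h1 := (hφ (0, s₀)).fst 0
    rw [hconst] at h1
    have h2 := h1.unique (hasDerivAt_const (0 : ℝ) _)
    rw [hφ0] at h2
    simp only at h2
    linarith [hs₀.1, hC.η_le_a]
  · intro t
    obtain ⟨u, hu, he⟩ := hrep t
    rw [he]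
    exact hbound s₀ hs₀ u hu.1
  · rintro q hq ⟨S, hS, hqper⟩ hqne hqr
    obtain ⟨t, s, hs, hqt⟩ := hq.exists_mem_section hg hg0 ha hC.b_pos hC.η_pos hr hS hqper
      hqne hqr
    have hrange : ∀ (p : ℝ → ℝ × ℝ) (u : ℝ), IsTrajectory g a p → range (φ (p u)) = range p := by
      intro p u hp
      ext z
      constructor
      · rintro ⟨v, rfl⟩; exact ⟨v + u, huniq p u hp v⟩
      · rintro ⟨v, rfl⟩
        exact ⟨v - u, by rw [← huniq p u hp, sub_add_cancel]⟩
    have h1 := hrange q t hq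
    rw [hqt] at h1
    have hcl : IsClosed (range (φ (0, s))) := by
      rw [h1]; exact (hqper.compact_of_continuous hS.ne' hq.continuous).isClosed
    obtain ⟨v, hv⟩ := hP.fixed_mem_range hs₀ hfix hs hcl
    have h2 := hrange _ v (hφ (0, s))
    rw [hv] at h2
    rw [← h1, h2]
  · set L := 2 * Real.exp (3 * M) with hLdef
    have hLpos : 0 < L := by positivity
    set ν := min 1 (ρ - η) / L with hν
    have hνpos : 0 < ν := div_pos (lt_min one_pos (by linarith)) hLpos
    have hLν : L * ν = min 1 (ρ - η) := by rw [hν]; field_simp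
    refine ⟨Metric.thickening ν (range (φ (0, s₀))), Metric.isOpen_thickening,
      Metric.self_subset_thickening hνpos _, fun z hz => ?_⟩
    obtain ⟨_, ⟨t₁, rfl⟩, hzt⟩ := Metric.mem_thickening_iff.1 hz
    obtain ⟨u, hu, he⟩ := hrep t₁
    rw [he] at hzt
    have hnear : ∀ t ∈ Icc 0 M, dist (φ z t) (φ (0, s₀) (t + u)) ≤ min 1 (ρ - η) := by
      intro t ht
      rw [hadd, ← hLν]
      exact (hgrow _ _ t ht).trans (by gcongr)
    have htri : ∀ v w : ℝ × ℝ, ‖v‖ ≤ dist v w + ‖w‖ := fun v w => by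
      rw [dist_eq_norm]; simpa using norm_add_le (v - w) w
    have hu' : τ s₀ - u ∈ Icc 0 M := ⟨by linarith [hu.2], by linarith [hu.1, hP.le_M _ hs₀]⟩
    have hw : ‖φ z (τ s₀ - u)‖ ≤ ρ := by
      have h1 := hnear _ hu'
      rw [sub_add_cancel, hτ] at h1
      have h2 := htri (φ z (τ s₀ - u)) (0, s₀)
      have h3 : ‖((0 : ℝ), s₀)‖ ≤ η := by
        rw [Prod.norm_def]
        simp only [norm_zero, Real.norm_eq_abs]
        exact max_le hC.η_pos.le (abs_le.2 hs₀)
      linarith [min_le_right 1 (ρ - η)]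
    obtain ⟨U, T₂, hU⟩ := (hφ (φ z (τ s₀ - u))).exists_returnArc hg hC hL (by rwa [hφ0])
    have hUmem := hU.end_mem hC hL
    have hT₂ : 0 ≤ T₂ := hL.T_pos.le.trans hU.le_time
    have hsplit : ∀ t, φ z t = φ (φ z (τ s₀ - u)) (t - (τ s₀ - u)) := fun t => by
      rw [← hadd, sub_add_cancel]
    have hsplit' : ∀ t, φ z t = φ (0, U 0) (t - (τ s₀ - u) - T₂) := fun t => by
      rw [hsplit, ← hU.end_eq, ← hadd _ _ T₂, sub_add_cancel]
    refine ⟨φ z, hφ0 z, hφ z, fun t ht => ?_, ?_⟩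
    · rcases le_total t (τ s₀ - u) with h | h
      · have h1 := hnear t ⟨ht, h.trans hu'.2⟩
        have h2 := htri (φ z t) (φ (0, s₀) (t + u))
        have h3 := hbound s₀ hs₀ (t + u) (add_nonneg ht hu.1)
        linarith [min_le_left 1 (ρ - η)]
      · rcases le_total (t - (τ s₀ - u)) T₂ with h' | h'
        · rw [hsplit]
          linarith [hU.norm_le _ ⟨sub_nonneg.2 h, h'⟩]
        · rw [hsplit']
          linarith [hbound _ hUmem _ (sub_nonneg.2 h')]
    · have := hP.tendsto_infDist hLpos.le hgrow hs₀ hfix hUmem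
      have hshift : Tendsto (fun t : ℝ => t - (τ s₀ - u) - T₂) atTop atTop :=
        (tendsto_atTop_add_const_right _ (-T₂)
          (tendsto_atTop_add_const_right _ (-(τ s₀ - u)) tendsto_id)).congr fun t => by
            simp [sub_eq_add_neg]
      refine (this.comp hshift).congr fun t => ?_
      simp only [Function.comp_apply]
      rw [hsplit' t]

end LimitCycle

section CorbeillerDamping

open Set

/-- The damping function of the Le Corbeiller system. -/
noncomputable def corbeillerDamping (b ε y : ℝ) : ℝ := b * y * (2 - Real.exp (y / ε))

variable {a b ε η k N M : ℝ}

lemma neg_one_le_exp_mul (s : ℝ) : -1 ≤ Real.exp s * (1 + s) := by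
  have h1 := Real.add_one_le_exp (-s)
  have h2 : Real.exp s * Real.exp (-s) = 1 := by rw [← Real.exp_add]; simp
  nlinarith [Real.exp_pos s]

lemma neg_mul_exp_le_one (s : ℝ) : -s * Real.exp s ≤ 1 := by
  have h1 := Real.add_one_le_exp (-s)
  have h2 : Real.exp s * Real.exp (-s) = 1 := by rw [← Real.exp_add]; simp
  nlinarith [Real.exp_pos s]

lemma exp_mul_one_add_le_one {s : ℝ} (hs : s ≤ 0) : Real.exp s * (1 + s) ≤ 1 := by
  have h1 := Real.exp_le_one_iff.2 hs
  nlinarith [Real.exp_pos s]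

lemma hasDerivAt_corbeillerDamping (b ε y : ℝ) : HasDerivAt (corbeillerDamping b ε)
    (b * (2 - Real.exp (y / ε) * (1 + y / ε))) y := by
  have h := ((hasDerivAt_id y).const_mul b).mul
    ((((hasDerivAt_id y).div_const ε).exp).const_sub 2)
  refine h.congr_deriv ?_
  simp only [id]
  ring

lemma corbeillerDamping_sub_le (hb : 0 < b) (hb1 : b < 1) {y z : ℝ} (h : z ≤ y) :
    corbeillerDamping b ε y - corbeillerDamping b ε z ≤ 3 * (y - z) := by
  refine sub_le_mul_of_deriv_le h (fun t _ => hasDerivAt_corbeillerDamping b ε t) fun t _ => ?_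
  nlinarith [neg_one_le_exp_mul (t / ε)]

lemma le_corbeillerDamping_sub (hb : 0 < b) (hε : 0 < ε) (hM : 0 ≤ M) {y z : ℝ} (h : z ≤ y)
    (hy : y ≤ M) : -(Real.exp (M / ε) * (1 + M / ε) * b) * (y - z) ≤
      corbeillerDamping b ε y - corbeillerDamping b ε z := by
  refine mul_le_sub_of_le_deriv h (fun t _ => hasDerivAt_corbeillerDamping b ε t) fun t ht => ?_
  have h1 : t / ε ≤ M / ε := by gcongr; exact ht.2.trans hy
  have h2 : Real.exp (t / ε) * (1 + t / ε) ≤ Real.exp (M / ε) * (1 + M / ε) := by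
    have hM0 : 0 ≤ M / ε := by positivity
    rcases le_total 0 (1 + t / ε) with h3 | h3
    · exact mul_le_mul (Real.exp_le_exp.2 h1) (by linarith) h3 (Real.exp_nonneg _)
    · exact (mul_nonpos_of_nonneg_of_nonpos (Real.exp_nonneg _) h3).trans (by positivity)
  nlinarith

lemma corbeillerDamping_le (hb : 0 < b) (hε : 0 < ε) (y : ℝ) :
    corbeillerDamping b ε y ≤ b * ε := by
  obtain ⟨s, rfl⟩ : ∃ s, y = s * ε := ⟨y / ε, by field_simp⟩
  unfold corbeillerDamping
  rw [mul_div_assoc, div_self hε.ne', mul_one]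
  have key : s * (2 - Real.exp s) ≤ 1 := by
    rcases le_total 0 s with h | h
    · nlinarith [Real.add_one_le_exp s, sq_nonneg (s - 1)]
    · nlinarith [Real.exp_le_one_iff.2 h]
  nlinarith [mul_pos hb hε]

lemma two_mul_le_corbeillerDamping (hb : 0 < b) {y : ℝ} (hy : y ≤ 0) :
    2 * b * y ≤ corbeillerDamping b ε y := by
  unfold corbeillerDamping
  nlinarith [mul_nonneg (mul_nonneg hb.le (neg_nonneg.2 hy)) (Real.exp_nonneg (y / ε))]

lemma corbeillerDamping_le_two_mul_add (hb : 0 < b) (hε : 0 < ε) (y : ℝ) :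
    corbeillerDamping b ε y ≤ 2 * b * y + b * ε := by
  obtain ⟨s, rfl⟩ : ∃ s, y = s * ε := ⟨y / ε, by field_simp⟩
  unfold corbeillerDamping
  rw [mul_div_assoc, div_self hε.ne', mul_one]
  nlinarith [mul_pos hb hε, neg_mul_exp_le_one s]

lemma mul_sub_le_corbeillerDamping_sub (hb : 0 < b) (hε : 0 < ε) {y z : ℝ} (h : z ≤ y)
    (hy : y ≤ 0) : b * (y - z) ≤ corbeillerDamping b ε y - corbeillerDamping b ε z := by
  refine mul_le_sub_of_le_deriv h (fun t _ => hasDerivAt_corbeillerDamping b ε t) fun t ht => ?_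
  have := exp_mul_one_add_le_one (div_nonpos_of_nonpos_of_nonneg (ht.2.trans hy) hε.le)
  nlinarith

lemma corbeillerDamping_le_of_le (hb : 0 < b) (hε : 0 < ε) (hη : 0 < η)
    (hN : 0 ≤ N) (h : ε * (2 + N / (b * η)) ≤ η) {y : ℝ} (hy : η ≤ y) : corbeillerDamping b ε y ≤ -N := by
  have h1 : 2 + N / (b * η) ≤ η / ε := by rw [le_div_iff₀ hε]; linarith
  have h2 : η / ε ≤ y / ε := by gcongr
  have h3 : y / ε + 1 ≤ Real.exp (y / ε) := Real.add_one_le_exp _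
  have h4 : N / (b * η) ≤ Real.exp (y / ε) - 2 := by linarith
  have h5 : 0 ≤ N / (b * η) := by positivity
  have h6 : N ≤ (Real.exp (y / ε) - 2) * (b * η) := (div_le_iff₀ (by positivity)).1 h4
  have h7 : (Real.exp (y / ε) - 2) * (b * η) ≤ (Real.exp (y / ε) - 2) * (b * y) := by
    have : 0 ≤ Real.exp (y / ε) - 2 := h5.trans h4
    gcongr
  unfold corbeillerDamping
  linarith

/-- The slope bound for `y ↦ g y / (y + a)` on an interval. -/
lemma mul_sub_le_of_hasDerivAt {G G' : ℝ → ℝ} {C : ℝ} {s : Set ℝ} [OrdConnected s]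
    (hG : ∀ t ∈ s, HasDerivAt G (G' t) t) (hG' : ∀ t ∈ s, G' t ≤ C) {y z : ℝ} (hy : y ∈ s)
    (hz : z ∈ s) : (y - z) * (G y - G z) ≤ C * (y - z) ^ 2 := by
  rcases le_total z y with h | h
  · have := sub_le_mul_of_deriv_le h (fun t ht => hG t (OrdConnected.out ‹_› hz hy ht))
      (fun t ht => hG' t (OrdConnected.out ‹_› hz hy ht))
    nlinarith
  · have := sub_le_mul_of_deriv_le h (fun t ht => hG t (OrdConnected.out ‹_› hy hz ht))
      (fun t ht => hG' t (OrdConnected.out ‹_› hy hz ht))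
    nlinarith

lemma hasDerivAt_corbeillerDamping_div (a b ε : ℝ) {y : ℝ} (hy : 0 < y + a) :
    HasDerivAt (fun y => corbeillerDamping b ε y / (y + a))
      (b * ((2 - Real.exp (y / ε)) * a - y / ε * Real.exp (y / ε) * (y + a)) / (y + a) ^ 2) y := by
  refine ((hasDerivAt_corbeillerDamping b ε y).div ((hasDerivAt_id y).add_const a)
    hy.ne').congr_deriv ?_
  simp only [id, corbeillerDamping]
  ring

lemma corbeillerDamping_expand (hb : 0 < b) (ha : 0 < a) {y z : ℝ} (hy : -(a / 2) ≤ y)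
    (hz : -(a / 2) ≤ z) :
    (y - z) * (corbeillerDamping b ε y / (y + a) - corbeillerDamping b ε z / (z + a)) ≤
      10 * b / a * (y - z) ^ 2 := by
  refine mul_sub_le_of_hasDerivAt (s := Ici (-(a / 2)))
    (fun t ht => hasDerivAt_corbeillerDamping_div a b ε (by linarith [mem_Ici.1 ht]))
    (fun t ht => ?_) hy hz
  have hta : a / 2 ≤ t + a := by linarith [mem_Ici.1 ht]
  have hta0 : 0 < t + a := by linarith
  rw [div_le_div_iff₀ (by positivity) ha]
  have h1 := neg_mul_exp_le_one (t / ε)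
  have h2 := Real.exp_pos (t / ε)
  have h3 : (2 - Real.exp (t / ε)) * a - t / ε * Real.exp (t / ε) * (t + a) ≤ 2 * a + (t + a) := by
    nlinarith
  have h4 : (2 * a + (t + a)) * a ≤ 10 * (t + a) ^ 2 := by nlinarith
  have h5 := mul_le_mul_of_nonneg_right h3 ha.le
  nlinarith

lemma corbeillerDamping_contract (hb : 0 < b) (ha : 0 < a) (hε : 0 < ε) (hk : 1 ≤ k)
    {y z : ℝ} (hy : ε * k ≤ y) (hz : ε * k ≤ z) (hy' : y ≤ a) (hz' : z ≤ a) :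
    (y - z) * (corbeillerDamping b ε y / (y + a) - corbeillerDamping b ε z / (z + a)) ≤
      -(b * k / (2 * a)) * (y - z) ^ 2 := by
  have hεk : 0 < ε * k := by positivity
  refine mul_sub_le_of_hasDerivAt (s := Icc (ε * k) a)
    (fun t ht => hasDerivAt_corbeillerDamping_div a b ε (by linarith [ht.1]))
    (fun t ht => ?_) ⟨hy, hy'⟩ ⟨hz, hz'⟩
  have hta0 : 0 < t + a := by linarith [ht.1]
  have hs : k ≤ t / ε := by rw [le_div_iff₀ hε]; linarith [ht.1]
  have h1 := Real.add_one_le_exp (t / ε)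
  have h2 : k ≤ t / ε * Real.exp (t / ε) := by nlinarith
  have h3 : (2 - Real.exp (t / ε)) * a - t / ε * Real.exp (t / ε) * (t + a) ≤ -(k * (t + a)) := by
    nlinarith
  rw [← neg_div, div_le_div_iff₀ (by positivity) (by positivity)]
  have h4 := mul_le_mul_of_nonneg_left h3 hb.le
  have h5 : b * k * (t + a) ^ 2 ≤ b * (k * (t + a)) * (2 * a) := by
    have : 0 ≤ b * k * (t + a) := by positivity
    nlinarith [ht.2]
  nlinarith

lemma dampingBounds_corbeillerDamping (ha : 0 < a) (hb : 0 < b) (hb1 : b < 1) (hε : 0 < ε)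
    (hη : 0 < η) (hηa : η ≤ a) (hηM : η ≤ M) (hk : 1 ≤ k)
    (hN0 : 0 ≤ N) (hN : ε * (2 + N / (b * η)) ≤ η) :
    DampingBounds (fun y => corbeillerDamping b ε (min y M)) a b (ε * (1 + k * Real.exp k))
      (ε * k) η N (10 * b / a) (b * k / (2 * a)) := by
  have hM : 0 ≤ M := by linarith
  have hmin : ∀ y ≤ η, min y M = y := fun y hy => min_eq_left (hy.trans hηM)
  have he : b * ε ≤ ε * (1 + k * Real.exp k) := by
    have : 0 ≤ ε * (k * Real.exp k) := by positivity
    nlinarith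
  have hmin_sub : ∀ y z, z ≤ y → min y M - min z M ≤ y - z := by
    intro y z h
    rcases le_total y M with h1 | h1 <;> rcases le_total z M with h2 | h2 <;>
      simp [h1, h2] <;> linarith
  have hup : ∀ y z, z ≤ y →
      corbeillerDamping b ε (min y M) - corbeillerDamping b ε (min z M) ≤ 3 * (y - z) := by
    intro y z h
    refine (corbeillerDamping_sub_le hb hb1 (min_le_min_right M h)).trans ?_
    linarith [hmin_sub y z h]
  refine ⟨?_, ?_, ?_, ?_, ?_, ?_, ?_, ?_, ?_, ?_⟩
  · have hL : 0 ≤ Real.exp (M / ε) * (1 + M / ε) * b := by positivity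
    refine ⟨(3 + Real.exp (M / ε) * (1 + M / ε) * b).toNNReal,
      LipschitzWith.of_le_add_mul _ fun y z => ?_⟩
    rw [Real.dist_eq, Real.coe_toNNReal _ (by positivity)]
    rcases le_total z y with h | h
    · rw [abs_of_nonneg (sub_nonneg.2 h)]
      nlinarith [hup y z h, mul_nonneg hL (sub_nonneg.2 h)]
    · rw [abs_of_nonpos (sub_nonpos.2 h)]
      have h1 := le_corbeillerDamping_sub hb hε hM (min_le_min_right M h) (min_le_right z M)
      have h2 := mul_le_mul_of_nonneg_left (hmin_sub z y h) hL
      linarith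
  · exact fun y => (corbeillerDamping_le hb hε _).trans he
  · intro y hy
    simp only [hmin y (hy.trans hη.le)]
    exact two_mul_le_corbeillerDamping hb hy
  · intro y hy
    simp only [hmin y (hy.trans hη.le)]
    linarith [corbeillerDamping_le_two_mul_add hb hε y]
  · intro y z
    rcases le_total z y with h | h
    · nlinarith [hup y z h]
    · nlinarith [hup z y h]
  · intro y hy hy'
    have h0 : 0 ≤ min y M := le_min hy hM
    have h1 : min y M ≤ ε * k := (min_le_left _ _).trans hy'
    have h2 : min y M / ε ≤ k := by rw [div_le_iff₀ hε]; linarith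
    have h3 : min y M * Real.exp (min y M / ε) ≤ ε * k * Real.exp k := by gcongr
    simp only [corbeillerDamping]
    have h4 : 0 ≤ b * min y M := by positivity
    have h5 : 0 ≤ ε * k * Real.exp k := by positivity
    nlinarith
  · exact fun y hy => corbeillerDamping_le_of_le hb hε hη hN0 hN (le_min hy hηM)
  · intro y z hy hz hy' hz'
    simp only [hmin y hy', hmin z hz']
    exact corbeillerDamping_expand hb ha hy hz
  · intro y z hy hz hy' hz'
    simp only [hmin y hy', hmin z hz']
    exact corbeillerDamping_contract hb ha hε hk hy hz (hy'.trans hηa) (hz'.trans hηa)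
  · intro y hy
    simp only [hmin y (hy.trans hη.le), hmin (-a) (by linarith)]
    rcases le_total (-a) y with h | h
    · nlinarith [mul_sub_le_corbeillerDamping_sub hb hε h hy]
    · nlinarith [mul_sub_le_corbeillerDamping_sub hb hε h (by linarith)]

end CorbeillerDamping

section Constants

open Set Filter Topology

lemma exists_lowerArc {a b : ℝ} (ha : 0 < a) (hb : 0 < b) (hb1 : b < 1) :
    ∃ (c δ σ ρ R T : ℝ) (x y : ℝ → ℝ), 0 < c ∧ c ≤ a / 4 ∧ 0 < δ ∧ 8 * δ ≤ c ∧
      δ ≤ c ^ 2 / (16 * a) ∧ ρ ≤ a ∧ 0 < ρ ∧ a ≤ R ∧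
      ∀ e, 0 ≤ e → e ≤ ρ → LowerArc a b c δ e σ ρ R T x y := by
  obtain ⟨x, y, T₀, hT₀, hx, hy, hx0, hy0, hyT, hxT, hneg⟩ := exists_reference_trajectory ha hb hb1
  have hxc : Continuous x := continuous_iff_continuousAt.2 fun t => (hx t).continuousAt
  have hyc : Continuous y := continuous_iff_continuousAt.2 fun t => (hy t).continuousAt
  obtain ⟨A, hA⟩ := isCompact_Icc.exists_bound_of_continuousOn (hxc.continuousOn (s := Icc 0 T₀))
  obtain ⟨B, hB⟩ := isCompact_Icc.exists_bound_of_continuousOn (hyc.continuousOn (s := Icc 0 T₀))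
  simp only [Real.norm_eq_abs] at hA hB
  have hA0 : 0 ≤ A := (abs_nonneg _).trans (hA 0 ⟨le_rfl, hT₀.le⟩)
  have hB0 : 0 ≤ B := (abs_nonneg _).trans (hB 0 ⟨le_rfl, hT₀.le⟩)
  set R := A + B + 1 + a with hR
  set c := min (-x T₀ / 8) (a / 4) with hc
  have hc0 : 0 < c := lt_min (by linarith) (by linarith)
  set δ := min (c / 8) (c ^ 2 / (16 * a)) with hδ
  have hδ0 : 0 < δ := lt_min (by linarith) (by positivity)
  obtain ⟨T, ⟨hTy, hTx⟩, hT, hTT⟩ : ∃ t, (-δ < y t ∧ x t < x T₀ / 2) ∧ t ∈ Ioo 0 T₀ := by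
    have h1 : ∀ᶠ t in 𝓝[<] T₀, -δ < y t :=
      (hyc.continuousAt.eventually (lt_mem_nhds (by rw [hyT]; linarith))).filter_mono
        nhdsWithin_le_nhds
    have h2 : ∀ᶠ t in 𝓝[<] T₀, x t < x T₀ / 2 :=
      (hxc.continuousAt.eventually (gt_mem_nhds (by linarith))).filter_mono nhdsWithin_le_nhds
    obtain ⟨t, h⟩ := ((h1.and h2).and (Ioo_mem_nhdsLT hT₀)).exists
    exact ⟨t, h⟩
  have hyneg := hneg T ⟨hT, hTT⟩
  set V := 2 * (R + 1) / a with hV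
  have hV0 : 0 ≤ V := by positivity
  set σ := min (min 1 δ) (min (-x T₀ / 4) (-y T / (1 + 2 * V))) with hσ
  have hσ0 : 0 < σ := lt_min (lt_min one_pos hδ0)
    (lt_min (by linarith) (div_pos (by linarith) (by linarith)))
  have hσ1 : σ ≤ 1 := (min_le_left _ _).trans (min_le_left _ _)
  have hσ2 : σ ≤ δ := (min_le_left _ _).trans (min_le_right _ _)
  have hσ3 : σ ≤ -x T₀ / 4 := (min_le_right _ _).trans (min_le_left _ _)
  have hσ4 : σ ≤ -y T / (1 + 2 * V) := (min_le_right _ _).trans (min_le_right _ _)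
  rw [le_div_iff₀ (by linarith)] at hσ4
  set ρ := min a (σ * Real.exp (-(7 * T)) / 2) with hρ
  have hρ0 : 0 < ρ := lt_min ha (by positivity)
  have hρ1 : ρ ≤ σ * Real.exp (-(7 * T)) / 2 := min_le_right _ _
  have hc1 : c ≤ -x T₀ / 8 := min_le_left _ _
  refine ⟨c, δ, σ, ρ, R, T, x, y, hc0, min_le_right _ _, hδ0, ?_, min_le_right _ _,
    min_le_left _ _, hρ0, by linarith, fun e he he' => ?_⟩
  · linarith [min_le_left (c / 8) (c ^ 2 / (16 * a))]
  have hmem : ∀ t ∈ Icc 0 T, t ∈ Icc 0 T₀ := fun t ht => ⟨ht.1, ht.2.trans hTT.le⟩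
  refine ⟨hT, hx, hy, hx0, hy0, fun t ht => ?_, fun t ht => ?_, fun t ht => ?_, ?_, ?_, ?_,
    by linarith, hσ0, hρ0, ?_⟩
  · rcases ht.1.eq_or_lt with h | h
    · rw [← h, hy0]
    · exact (hneg t ⟨h, ht.2.trans_lt hTT⟩).le
  · linarith [hA t (hmem t ht)]
  · linarith [hB t (hmem t ht)]
  · linarith
  · nlinarith
  · linarith
  · have h1 : Real.exp (-(7 * T)) * Real.exp (7 * T) = 1 := by rw [← Real.exp_add]; simp
    have h2 : Real.exp (-(7 * T)) ≤ 1 := Real.exp_le_one_iff.2 (by linarith)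
    have h3 : ρ * Real.exp (7 * T) ≤ σ / 2 := by
      have := mul_le_mul_of_nonneg_right hρ1 (Real.exp_pos (7 * T)).le
      have h4 : σ * Real.exp (-(7 * T)) / 2 * Real.exp (7 * T) =
        σ / 2 * (Real.exp (-(7 * T)) * Real.exp (7 * T)) := by ring
      rw [h4, h1] at this
      linarith
    have h4 : ρ ≤ σ / 2 := by nlinarith
    have h5 : e ^ 2 ≤ ρ ^ 2 := pow_le_pow_left₀ he he' 2
    calc (2 * ρ ^ 2 + e ^ 2) * Real.exp (7 * T) ≤ (2 * ρ ^ 2 + ρ ^ 2) * Real.exp (7 * T) := by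
          gcongr
      _ = 3 * (ρ * (ρ * Real.exp (7 * T))) := by ring
      _ ≤ 3 * (σ / 2 * (σ / 2)) := by gcongr
      _ ≤ σ ^ 2 := by nlinarith [sq_nonneg σ]

lemma exists_mul_exp_sub_le (A B : ℝ) {D : ℝ} (hD : 0 < D) :
    ∃ k ≥ (1 : ℝ), A * Real.exp (B - D * k) ≤ 1 / 4 := by
  refine ⟨max 1 (4 * A * Real.exp B / D), le_max_left _ _, ?_⟩
  set k := max 1 (4 * A * Real.exp B / D)
  have h1 : 4 * A * Real.exp B ≤ k * D := (div_le_iff₀ hD).1 (le_max_right _ _)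
  have h2 := Real.add_one_le_exp (D * k)
  rw [Real.exp_sub, ← mul_div_assoc, div_le_iff₀ (Real.exp_pos _)]
  linarith

end Constants

lemma corbeillerField_eq_planarField (a b ε : ℝ) {M : ℝ} {z : ℝ × ℝ} (hz : ‖z‖ ≤ M) :
    corbeillerField a b ε z = planarField (fun y => corbeillerDamping b ε (min y M)) a z := by
  have h : z.2 ≤ M := (le_abs_self _).trans ((norm_snd_le z).trans hz)
  simp only [corbeillerField, planarField, corbeillerDamping, min_eq_left h]

/-- Existence, uniqueness and attractivity of the limit cycle of the Le Corbeiller system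
for small `ε > 0`. -/
theorem corbeiller_limit_cycle (a b : ℝ) (ha : 0 < a) (hb : b ∈ Set.Ioo (0 : ℝ) 1) :
    ∃ R > (0 : ℝ), ∀ r : ℝ, R ≤ r → ∃ ε₀ > (0 : ℝ), ∀ ε ∈ Set.Ioo (0 : ℝ) ε₀,
      ∃ p : ℝ → ℝ × ℝ,
        IsPeriodicSol (corbeillerField a b ε) p ∧
        Set.range p ⊆ Metric.closedBall (0 : ℝ × ℝ) r ∧
        (∀ q : ℝ → ℝ × ℝ, IsPeriodicSol (corbeillerField a b ε) q →
          Set.range q ⊆ Metric.closedBall (0 : ℝ × ℝ) r → Set.range q = Set.range p) ∧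
        (∃ U : Set (ℝ × ℝ), IsOpen U ∧ Set.range p ⊆ U ∧
          ∀ z ∈ U, ∃ q : ℝ → ℝ × ℝ, q 0 = z ∧
            (∀ t : ℝ, 0 ≤ t → HasDerivAt q (corbeillerField a b ε (q t)) t) ∧
            Filter.Tendsto (fun t => Metric.infDist (q t) (Set.range p))
              Filter.atTop (nhds 0)) := by
  obtain ⟨hb0, hb1⟩ := hb
  obtain ⟨c, δ, σ, ρ, R, T, x, y, hc, hca, hδ, hδc, hδc2, hρa, hρ, haR, hL⟩ :=
    exists_lowerArc ha hb0 hb1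
  have hR : 0 < R := ha.trans_le haR
  obtain ⟨k, hk, hcontr⟩ := exists_mul_exp_sub_le
    ((1 + 2 * (R + 1) / a) ^ 2 * Real.exp (6 * T)) (2 * (10 * b / a) * R)
    (D := b * c / (2 * a)) (by positivity)
  refine ⟨R, hR, fun r hr => ?_⟩
  have hr0 : 0 < r := hR.trans_le hr
  set C := (1 + k * Real.exp k) + k + (2 + (r + 1) / (b * (ρ / 2))) with hC
  have hk0 : 0 < k := by linarith
  have hC1 : 0 < 1 + k * Real.exp k := by positivity
  have hC3 : 0 < 2 + (r + 1) / (b * (ρ / 2)) := by positivity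
  have hCpos : 0 < C := by positivity
  set B := min (min (min 1 (c / 8)) (min (ρ / 2) a)) (c ^ 2 / (16 * a)) with hB
  have hBpos : 0 < B := lt_min (lt_min (lt_min one_pos (by linarith)) (lt_min (by linarith) ha))
    (by positivity)
  have hB1 : B ≤ 1 := (min_le_left _ _).trans ((min_le_left _ _).trans (min_le_left _ _))
  have hB2 : B ≤ c / 8 := (min_le_left _ _).trans ((min_le_left _ _).trans (min_le_right _ _))
  have hB3 : B ≤ ρ / 2 := (min_le_left _ _).trans ((min_le_right _ _).trans (min_le_left _ _))
  have hB4 : B ≤ a := (min_le_left _ _).trans ((min_le_right _ _).trans (min_le_right _ _))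
  have hB5 : B ≤ c ^ 2 / (16 * a) := min_le_right _ _
  refine ⟨B / C, by positivity, fun ε hε => ?_⟩
  obtain ⟨hε0, hε1⟩ := hε
  rw [lt_div_iff₀ hCpos] at hε1
  have hεC : ε * C = ε * (1 + k * Real.exp k) + ε * k +
    ε * (2 + (r + 1) / (b * (ρ / 2))) := by rw [hC]; ring
  have he1 : 0 < ε * (1 + k * Real.exp k) := by positivity
  have he2 : 0 < ε * k := by positivity
  have he3 : 0 < ε * (2 + (r + 1) / (b * (ρ / 2))) := by positivity
  have hg := dampingBounds_corbeillerDamping (η := ρ / 2) (N := r + 1) (M := r + 1) ha hb0 hb1 hε0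
    (by linarith) (by linarith) (by linarith) hk (by linarith) (by linarith)
  have hAC : ArcConstants a b c δ (ε * (1 + k * Real.exp k)) (ε * k) (ρ / 2) R (r + 1)
      (10 * b / a) (b * k / (2 * a)) := by
    have h16 : c ^ 2 / (4 * a) = 4 * (c ^ 2 / (16 * a)) := by field_simp; norm_num
    have hcc : 0 < c ^ 2 / (16 * a) := by positivity
    refine ⟨ha, hb0, hb1, hc, hca, hδ, by linarith, hδc, he1, by linarith, by linarith, he2,
      by linarith, by rw [h16]; linarith, by linarith, by linarith, hR, by linarith,
      by positivity, by positivity⟩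
  obtain ⟨p, hp, ⟨S, hS, hper⟩, hne, hpR, huniq, U, hUo, hpU, hU⟩ := exists_limitCycle (r := r) hg
    (by simp [corbeillerDamping, min_eq_left (by linarith : (0 : ℝ) ≤ r + 1)]) hAC
    (hL _ he1.le (by linarith)) (by linarith)
    (by convert hcontr using 3; ring) (by linarith)
  have hfield : ∀ z : ℝ × ℝ, ‖z‖ ≤ r + 1 → corbeillerField a b ε z =
      planarField (fun y => corbeillerDamping b ε (min y (r + 1))) a z := fun z hz =>
    corbeillerField_eq_planarField a b ε hz
  refine ⟨p, ⟨fun t => ?_, ⟨S, hS, hper⟩, hne⟩, ?_, ?_, U, hUo, hpU, fun z hz => ?_⟩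
  · rw [hfield _ (by linarith [hpR t])]
    exact hp t
  · rintro _ ⟨t, rfl⟩
    exact mem_closedBall_zero_iff.2 ((hpR t).trans hr)
  · rintro q ⟨hq, ⟨S', hS', hqper⟩, hqne⟩ hqr
    have hqr' : ∀ t, ‖q t‖ ≤ r := fun t => mem_closedBall_zero_iff.1 (hqr ⟨t, rfl⟩)
    refine huniq q (fun t => ?_) ⟨S', hS', hqper⟩ hqne hqr'
    rw [← hfield _ (by linarith [hqr' t])]
    exact hq t
  · obtain ⟨q, hq0, hq, hqR, hlim⟩ := hU z hz
    refine ⟨q, hq0, fun t ht => ?_, hlim⟩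
    rw [hfield _ (by linarith [hqR t ht])]
    exact hq t
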